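/- For every δ ∈ (0, √(σ₁₁/σ₁₂)·dist(x*, ∂D)) and every ρ > 0 there exist μ̄ > 0, a threshold γ̄₁(μ) > 0 for each μ ∈ (0, μ̄], and a threshold ε̄(γ₁, μ) > 0, such that for all μ ∈ (0, μ̄], all γ₁ ≥ γ̄₁(μ), and all ε ∈ (0, ε̄(γ₁, μ)], there exist constants β, λ > 0 such that every π_ε-solution (x(t), ξ(t)) of the closed-loop system with initial condition x(0) = ξ(0) = x⁰ ∈ closed ball B̄_δ(x*) satisfies ‖x(t) − x*‖ ≤ β‖x⁰ − x*‖e^{−λt} + ρ for all t ∈ [0, ∞). -/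

import Mathlib

open Real Set Metric Matrix

noncomputable section

/-- The Lie bracket `[f,g](x) = Dg(x)·f(x) − Df(x)·g(x)` of vector fields on ℝⁿ. -/
def lieBracket {n : ℕ} (f g : EuclideanSpace ℝ (Fin n) → EuclideanSpace ℝ (Fin n))
    (x : EuclideanSpace ℝ (Fin n)) : EuclideanSpace ℝ (Fin n) :=
  fderiv ℝ g x (f x) - fderiv ℝ f x (g x)

/-- The `j`-th column of the matrix `F(x)`: the field `f_{i₁}(x)` for indices coming from
`S₁` and the bracket `[f_{j₁},f_{j₂}](x)` for indices coming from `S₂`, according to the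
enumeration `idx` of `S₁ ⊕ S₂` by `Fin n`. -/
def col {n m : ℕ} (f : Fin m → EuclideanSpace ℝ (Fin n) → EuclideanSpace ℝ (Fin n))
    (S₁ : Finset (Fin m)) (S₂ : Finset (Fin m × Fin m))
    (idx : (↥S₁ ⊕ ↥S₂) ≃ Fin n) (x : EuclideanSpace ℝ (Fin n)) (j : Fin n) :
    EuclideanSpace ℝ (Fin n) :=
  match idx.symm j with
  | Sum.inl i₁ => f i₁ x
  | Sum.inr p => lieBracket (f p.1.1) (f p.1.2) x

/-- The matrix `F(x)` whose columns are `f_{j₁}(x)` (`j₁ ∈ S₁`) and `[f_{j₁},f_{j₂}](x)`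
(`(j₁,j₂) ∈ S₂`). -/
def Fmat {n m : ℕ} (f : Fin m → EuclideanSpace ℝ (Fin n) → EuclideanSpace ℝ (Fin n))
    (S₁ : Finset (Fin m)) (S₂ : Finset (Fin m × Fin m))
    (idx : (↥S₁ ⊕ ↥S₂) ≃ Fin n) (x : EuclideanSpace ℝ (Fin n)) :
    Matrix (Fin n) (Fin n) ℝ :=
  Matrix.of fun i j => col f S₁ S₂ idx x j i

/-- The state-dependent coefficient vector `a(x,ξ) = −γ₁F(x)⁻¹(x − ξ)`. -/
def avec {n m : ℕ} (f : Fin m → EuclideanSpace ℝ (Fin n) → EuclideanSpace ℝ (Fin n))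
    (S₁ : Finset (Fin m)) (S₂ : Finset (Fin m × Fin m))
    (idx : (↥S₁ ⊕ ↥S₂) ≃ Fin n) (γ₁ : ℝ) (x ξ : EuclideanSpace ℝ (Fin n)) :
    Fin n → ℝ :=
  (-γ₁) • ((Fmat f S₁ S₂ idx x)⁻¹ *ᵥ (fun i => x i - ξ i))

/-- The sampled fast-oscillating stabilizing control
`φᵢ^ε(x,ξ,t) = Σ_{i₁∈S₁}a_{i₁}(x,ξ)δ_{ii₁} + √(4π/ε)Σ_{(i₁,i₂)∈S₂}√(κ_{i₁i₂}|a_{i₁i₂}(x,ξ)|)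
(δ_{ii₁}sign(a_{i₁i₂}(x,ξ))cos(2πκ_{i₁i₂}t/ε) + δ_{ii₂}sin(2πκ_{i₁i₂}t/ε))`. -/
def ctrl {n m : ℕ} (f : Fin m → EuclideanSpace ℝ (Fin n) → EuclideanSpace ℝ (Fin n))
    (S₁ : Finset (Fin m)) (S₂ : Finset (Fin m × Fin m))
    (idx : (↥S₁ ⊕ ↥S₂) ≃ Fin n) (κ : Fin m × Fin m → ℕ) (γ₁ ε : ℝ)
    (x ξ : EuclideanSpace ℝ (Fin n)) (i : Fin m) (t : ℝ) : ℝ :=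
  (∑ i₁ ∈ S₁.attach, avec f S₁ S₂ idx γ₁ x ξ (idx (Sum.inl i₁)) * (if i = ↑i₁ then 1 else 0))
  + Real.sqrt (4 * π / ε) * ∑ p ∈ S₂.attach,
      Real.sqrt (κ p.1 * |avec f S₁ S₂ idx γ₁ x ξ (idx (Sum.inr p))|) *
        ((if i = p.1.1 then (1:ℝ) else 0) * Real.sign (avec f S₁ S₂ idx γ₁ x ξ (idx (Sum.inr p))) *
            Real.cos (2 * π * κ p.1 * t / ε) +
          (if i = p.1.2 then (1:ℝ) else 0) * Real.sin (2 * π * κ p.1 * t / ε))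

/-- The dithers `v_j^μ` of the extremum-seeking dynamic extension: `√(4πk_j/μ)cos(2πk_jt/μ)`
for the first `n` indices and `√(4πk_j/μ)sin(2πk_jt/μ)` for the last `n` indices. -/
def dither {n : ℕ} (k : Fin n → ℕ) (μ : ℝ) : (Fin n ⊕ Fin n) → ℝ → ℝ
  | Sum.inl j, t => Real.sqrt (4 * π * k j / μ) * Real.cos (2 * π * k j * t / μ)
  | Sum.inr j, t => Real.sqrt (4 * π * k j / μ) * Real.sin (2 * π * k j * t / μ)

/-- The vector field `g_j(J(x))e_j` of the dynamic extension (`e_j` is the `j`-th standard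
basis vector for `j ≤ n` and the `(j−n)`-th one for `n+1 ≤ j ≤ 2n`). -/
def Gfield {n : ℕ} (g : Fin n ⊕ Fin n → ℝ → ℝ) (J : EuclideanSpace ℝ (Fin n) → ℝ)
    (j : Fin n ⊕ Fin n) (x : EuclideanSpace ℝ (Fin n)) : EuclideanSpace ℝ (Fin n) :=
  g j (J x) • EuclideanSpace.single (Sum.elim id id j) (1 : ℝ)


section Generic

lemma disp_bound {E : Type*} [NormedAddCommGroup E] [NormedSpace ℝ E] {y y' : ℝ → E}
    {a b C C' d : ℝ} (hy : ContinuousOn y (Icc a b))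
    (hy' : ∀ t ∈ Ico a b, HasDerivWithinAt y (y' t) (Ici t) t)
    (hb : ∀ t ∈ Ico a b, ‖y t - y a‖ ≤ d → ‖y' t‖ ≤ C') (hC : C' < C) (hC0 : 0 ≤ C)
    (hd : C * (b - a) ≤ d) : ∀ t ∈ Icc a b, ‖y t - y a‖ ≤ C * (t - a) := by
  intro t ht
  refine image_norm_le_of_norm_deriv_right_lt_deriv_boundary' (f := fun t => y t - y a)
    (f' := y') (B := fun t => C * (t - a)) (B' := fun _ => C) (a := a) (b := b)
    (hy.sub continuousOn_const) (fun x hx => (hy' x hx).sub_const _) (by simp)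
    (by fun_prop) (fun x hx => ?_) (fun x hx hxe => ?_) ht
  · have := ((hasDerivAt_id x).sub_const a).const_mul C
    simpa using this.hasDerivWithinAt
  · refine lt_of_le_of_lt (hb x hx ?_) hC
    rw [hxe]
    refine le_trans (mul_le_mul_of_nonneg_left ?_ hC0) hd
    linarith [hx.2]

lemma unif_diff {E F : Type*} [NormedAddCommGroup E] [NormedSpace ℝ E] [ProperSpace E]
    [NormedAddCommGroup F] [NormedSpace ℝ F] {D K : Set E} (hD : IsOpen D) (hK : IsCompact K)
    (hKD : K ⊆ D) {h : E → F} (hh : ContDiffOn ℝ 2 h D) {η : ℝ} (hη : 0 < η) :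
    ∃ d > 0, ∀ x ∈ K, ∀ y, ‖y - x‖ ≤ d → ‖h y - h x - fderiv ℝ h x (y - x)‖ ≤ η * ‖y - x‖ := by
  obtain ⟨d0, hd0, hsub⟩ := hK.exists_cthickening_subset_open hD hKD
  have hcont : ContinuousOn (fderiv ℝ h) D := hh.continuousOn_fderiv_of_isOpen hD (by norm_num)
  have huc := (hK.cthickening (r := d0)).uniformContinuousOn_of_continuous (hcont.mono hsub)
  rw [Metric.uniformContinuousOn_iff_le] at huc
  obtain ⟨d1, hd1, huc⟩ := huc η hη
  refine ⟨min d0 d1, lt_min hd0 hd1, fun x hx y hxy => ?_⟩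
  have hball : ∀ z ∈ closedBall x (min d0 d1), z ∈ cthickening d0 K := by
    intro z hz
    refine Metric.mem_cthickening_of_dist_le z x d0 K hx ?_
    exact (mem_closedBall.1 hz).trans (min_le_left _ _)
  refine Convex.norm_image_sub_le_of_norm_fderiv_le' (𝕜 := ℝ) (s := closedBall x (min d0 d1))
    (fun z hz => ?_) (fun z hz => ?_) (convex_closedBall _ _) ?_ ?_
  · exact (hh.differentiableOn (by norm_num)).differentiableAt (hD.mem_nhds (hsub (hball z hz)))
  · rw [← dist_eq_norm]
    refine huc z (hball z hz) x (hball x ?_) ?_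
    · exact mem_closedBall_self (le_min hd0.le hd1.le)
    · exact (mem_closedBall.1 hz).trans (min_le_right _ _)
  · exact mem_closedBall_self (le_min hd0.le hd1.le)
  · rw [mem_closedBall, dist_eq_norm]; exact hxy

lemma norm_sum_smul_le {E : Type*} [NormedAddCommGroup E] [NormedSpace ℝ E] {ι : Type*} [Fintype ι]
    (u : ι → ℝ) (w : ι → E) {U W : ℝ} (hU : 0 ≤ U) (hu : ∀ i, |u i| ≤ U) (hw : ∀ i, ‖w i‖ ≤ W) :
    ‖∑ i, u i • w i‖ ≤ Fintype.card ι * (U * W) := by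
  refine (norm_sum_le _ _).trans ?_
  calc ∑ i, ‖u i • w i‖ ≤ ∑ _i : ι, U * W := by
        refine Finset.sum_le_sum fun i _ => ?_
        rw [norm_smul, Real.norm_eq_abs]
        exact mul_le_mul (hu i) (hw i) (norm_nonneg _) hU
    _ = _ := by simp

lemma expand2 {E : Type*} [NormedAddCommGroup E] [NormedSpace ℝ E]
    {ι : Type*} [Fintype ι] (u V : ι → ℝ → ℝ) (h : ι → E → E) (h' : ι → E →L[ℝ] E)
    (y e : ℝ → E) (b : E) (a T U L η Δ B₀ E₀ : ℝ)
    (hT : 0 < T) (hU : 0 ≤ U) (hη : 0 ≤ η)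
    (hu : ∀ i, Continuous (u i)) (hV : ∀ i t, HasDerivAt (V i) (u i t) t)
    (hVa : ∀ i, V i a = 0) (huU : ∀ i t, |u i t| ≤ U)
    (hy : ContinuousOn y (Icc a (a + T)))
    (hy' : ∀ t ∈ Ico a (a + T), HasDerivWithinAt y (b + e t + ∑ i, u i t • h i (y t)) (Ici t) t)
    (he : ∀ t ∈ Ico a (a + T), ‖e t‖ ≤ E₀) (hb : ‖b‖ ≤ B₀)
    (hΔ : ∀ t ∈ Icc a (a + T), ‖y t - y a‖ ≤ Δ)
    (hmod : ∀ i z, ‖z - y a‖ ≤ Δ → ‖h i z - h i (y a) - h' i (z - y a)‖ ≤ η * ‖z - y a‖)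
    (hL : ∀ i, ‖h' i‖ ≤ L) (hL0 : 0 ≤ L) :
    ‖y (a + T) - y a - T • b - ∑ i, V i (a + T) • h i (y a)
      - ∑ j, ∑ i, (∫ t in a..a + T, u j t * V i t) • h' j (h i (y a))‖
      ≤ T * (E₀ + Fintype.card ι * (U * (η * Δ +
          L * (T * (B₀ + E₀ + Fintype.card ι * (U * ((L + η) * Δ))))))) := by
  have haT : a ≤ a + T := by linarith
  have hVc : ∀ i, Continuous (V i) := fun i =>
    continuous_iff_continuousAt.2 fun t => (hV i t).continuousAt
  have hE0 : 0 ≤ E₀ := (norm_nonneg _).trans (he a ⟨le_rfl, by linarith⟩)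
  have hB0 : 0 ≤ B₀ := (norm_nonneg _).trans hb
  have hΔ0 : 0 ≤ Δ := (norm_nonneg _).trans (hΔ a ⟨le_rfl, haT⟩)
  -- increments of the fields
  have hinc : ∀ t ∈ Icc a (a + T), ∀ i, ‖h i (y t) - h i (y a)‖ ≤ (L + η) * Δ := by
    intro t ht i
    have h1 := hmod i (y t) (hΔ t ht)
    have h2 : ‖h' i (y t - y a)‖ ≤ L * ‖y t - y a‖ := (h' i).le_of_opNorm_le (hL i) _
    have h3 : h i (y t) - h i (y a) = (h i (y t) - h i (y a) - h' i (y t - y a))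
        + h' i (y t - y a) := by abel
    rw [h3]
    refine (norm_add_le _ _).trans ?_
    have h4 := mul_le_mul_of_nonneg_left (hΔ t ht) (add_nonneg hL0 hη)
    nlinarith
  set B₁ : ℝ := B₀ + E₀ + Fintype.card ι * (U * ((L + η) * Δ)) with hB1
  have hB1nn : 0 ≤ B₁ := by positivity
  -- first order remainder
  have hP : ∀ t ∈ Icc a (a + T), ‖y t - y a - ∑ i, V i t • h i (y a)‖ ≤ T * B₁ := by
    intro t ht
    have key := norm_image_sub_le_of_norm_deriv_right_le_segment
      (f := fun t => y t - y a - ∑ i, V i t • h i (y a))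
      (f' := fun t => b + e t + ∑ i, u i t • h i (y t) - ∑ i, u i t • h i (y a))
      (a := a) (b := a + T) (C := B₁) ?_ ?_ ?_ t ht
    · simp only [hVa, zero_smul, Finset.sum_const_zero, sub_self, sub_zero] at key
      refine key.trans ?_
      rw [mul_comm]
      exact mul_le_mul_of_nonneg_right (by linarith [ht.2]) hB1nn
    · refine (hy.sub continuousOn_const).sub (Continuous.continuousOn ?_)
      exact continuous_finsetSum _ fun i _ => (hVc i).smul continuous_const
    · intro s hs
      refine ((hy' s hs).sub_const _).sub ?_
      refine HasDerivWithinAt.fun_sum fun i _ => ?_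
      exact ((hV i s).smul_const _).hasDerivWithinAt
    · intro s hs
      have e1 : b + e s + ∑ i, u i s • h i (y s) - ∑ i, u i s • h i (y a)
          = b + e s + ∑ i, u i s • (h i (y s) - h i (y a)) := by
        simp only [smul_sub, Finset.sum_sub_distrib]; abel
      rw [e1]
      refine (norm_add_le _ _).trans ?_
      have := norm_sum_smul_le (fun i => u i s) (fun i => h i (y s) - h i (y a)) hU
        (fun i => huU i s) (fun i => hinc s ⟨hs.1, hs.2.le⟩ i)
      have h5 := norm_add_le b (e s)
      have h6 := he s hs
      simp only [hB1]; linarith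
  have key := norm_image_sub_le_of_norm_deriv_right_le_segment
      (f := fun t => y t - y a - (t - a) • b - ∑ i, V i t • h i (y a)
        - ∑ j, ∑ i, (∫ s in a..t, u j s * V i s) • h' j (h i (y a)))
      (f' := fun t => b + e t + ∑ i, u i t • h i (y t) - (1 : ℝ) • b - ∑ i, u i t • h i (y a)
        - ∑ j, ∑ i, (u j t * V i t) • h' j (h i (y a)))
      (a := a) (b := a + T) (C := (E₀ + Fintype.card ι * (U * (η * Δ +
          L * (T * B₁))))) ?_ ?_ ?_ (a + T) ⟨haT, le_rfl⟩
  · simp only [hVa, zero_smul, Finset.sum_const_zero, sub_self, sub_zero,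
      intervalIntegral.integral_same, add_sub_cancel_left] at key
    rw [mul_comm T]; exact key
  · refine ((((hy.sub continuousOn_const).sub (by fun_prop)).sub
      (Continuous.continuousOn ?_))).sub (Continuous.continuousOn ?_)
    · exact continuous_finsetSum _ fun i _ => (hVc i).smul continuous_const
    · refine continuous_finsetSum _ fun j _ => continuous_finsetSum _ fun i _ => ?_
      refine Continuous.smul ?_ continuous_const
      exact continuous_iff_continuousAt.2 fun t =>
        (((hu j).mul (hVc i)).integral_hasStrictDerivAt a t).hasDerivAt.continuousAt
  · intro s hs
    refine ((((hy' s hs).sub_const _).sub ?_).sub ?_).sub ?_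
    · exact (((hasDerivAt_id s).sub_const a).smul_const b).hasDerivWithinAt
    · refine HasDerivWithinAt.fun_sum fun i _ => ?_
      exact ((hV i s).smul_const _).hasDerivWithinAt
    · refine HasDerivWithinAt.fun_sum fun j _ => HasDerivWithinAt.fun_sum fun i _ => ?_
      exact (((((hu j).mul (hVc i)).integral_hasStrictDerivAt a s).hasDerivAt).smul_const
        _).hasDerivWithinAt
  · intro s hs
    have e1 : b + e s + ∑ i, u i s • h i (y s) - (1 : ℝ) • b - ∑ i, u i s • h i (y a)
        - ∑ j, ∑ i, (u j s * V i s) • h' j (h i (y a))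
        = e s + ∑ j, u j s • ((h j (y s) - h j (y a) - h' j (y s - y a))
            + h' j (y s - y a - ∑ i, V i s • h i (y a))) := by
      simp only [smul_sub, smul_add, Finset.sum_sub_distrib, Finset.sum_add_distrib, map_sub,
        map_sum, map_smul, Finset.smul_sum, mul_smul, one_smul]
      abel
    rw [e1]
    refine (norm_add_le _ _).trans (add_le_add (he s hs) ?_)
    refine norm_sum_smul_le (fun i => u i s) _ hU (fun i => huU i s) (fun i => ?_)
    have hs' : s ∈ Icc a (a + T) := ⟨hs.1, hs.2.le⟩
    refine (norm_add_le _ _).trans (add_le_add ?_ ?_)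
    · exact (hmod i (y s) (hΔ s hs')).trans (mul_le_mul_of_nonneg_left (hΔ s hs') hη)
    · refine ((h' i).le_of_opNorm_le (hL i) _).trans (mul_le_mul_of_nonneg_left (hP s hs') hL0)

end Generic

section Trig

lemma trig_end (T : ℝ) (hT : 0 < T) (j : ℕ) (z : ℤ) :
    Real.sin (2 * π * z * (T * j) / T) = 0 ∧ Real.cos (2 * π * z * (T * j) / T) = 1 ∧
    Real.sin (2 * π * z * (T * j + T) / T) = 0 ∧ Real.cos (2 * π * z * (T * j + T) / T) = 1 := by
  have e1 : 2 * π * z * (T * j) / T = ((z * j : ℤ) : ℝ) * (2 * π) := by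
    push_cast; field_simp
  have e2 : 2 * π * z * (T * j + T) / T = ((z * (j + 1) : ℤ) : ℝ) * (2 * π) := by
    push_cast; field_simp
  rw [e1, e2]
  refine ⟨?_, Real.cos_int_mul_two_pi _, ?_, Real.cos_int_mul_two_pi _⟩
  · have := Real.sin_int_mul_pi ((z * j) * 2)
    rw [← this]; push_cast; ring_nf
  · have := Real.sin_int_mul_pi ((z * (j + 1)) * 2)
    rw [← this]; push_cast; ring_nf

lemma int_cos (T : ℝ) (hT : 0 < T) (j : ℕ) (z : ℤ) :
    ∫ t in (T * j)..(T * j + T), Real.cos (2 * π * z * t / T) = if z = 0 then T else 0 := by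
  split_ifs with h
  · simp [h]
  · have hz : (z : ℝ) ≠ 0 := by exact_mod_cast h
    have hc : 2 * π * z / T ≠ 0 := by positivity
    have hd : ∀ t ∈ uIcc (T * j) (T * j + T), HasDerivAt
        (fun t => (2 * π * z / T)⁻¹ * Real.sin (2 * π * z * t / T)) (Real.cos (2 * π * z * t / T)) t := by
      intro t _
      have h1 : HasDerivAt (fun t : ℝ => 2 * π * z * t / T) (2 * π * z / T) t := by
        simpa using ((hasDerivAt_id t).const_mul (2 * π * z)).div_const T
      have := (h1.sin).const_mul (2 * π * z / T)⁻¹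
      refine this.congr_deriv ?_
      field_simp
    rw [intervalIntegral.integral_eq_sub_of_hasDerivAt hd
      (Continuous.intervalIntegrable (by fun_prop) _ _)]
    obtain ⟨h1, _, h2, _⟩ := trig_end T hT j z
    rw [h1, h2]; simp

lemma int_sin (T : ℝ) (hT : 0 < T) (j : ℕ) (z : ℤ) :
    ∫ t in (T * j)..(T * j + T), Real.sin (2 * π * z * t / T) = 0 := by
  by_cases h : z = 0
  · simp [h]
  · have hz : (z : ℝ) ≠ 0 := by exact_mod_cast h
    have hc : 2 * π * z / T ≠ 0 := by positivity
    have hd : ∀ t ∈ uIcc (T * j) (T * j + T), HasDerivAt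
        (fun t => -((2 * π * z / T)⁻¹ * Real.cos (2 * π * z * t / T))) (Real.sin (2 * π * z * t / T)) t := by
      intro t _
      have h1 : HasDerivAt (fun t : ℝ => 2 * π * z * t / T) (2 * π * z / T) t := by
        simpa using ((hasDerivAt_id t).const_mul (2 * π * z)).div_const T
      have := ((h1.cos).const_mul (2 * π * z / T)⁻¹).neg
      refine this.congr_deriv ?_
      field_simp
    rw [intervalIntegral.integral_eq_sub_of_hasDerivAt hd
      (Continuous.intervalIntegrable (by fun_prop) _ _)]
    obtain ⟨_, h1, _, h2⟩ := trig_end T hT j z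
    rw [h1, h2]; simp

lemma int_cc (T : ℝ) (hT : 0 < T) (j k l : ℕ) (hk : 0 < k) :
    ∫ t in (T * j)..(T * j + T), Real.cos (2 * π * k * t / T) * Real.cos (2 * π * l * t / T)
      = if k = l then T / 2 else 0 := by
  have e : ∀ t : ℝ, Real.cos (2 * π * k * t / T) * Real.cos (2 * π * l * t / T)
      = (1 / 2) * (Real.cos (2 * π * ((k - l : ℤ) : ℝ) * t / T)
        + Real.cos (2 * π * ((k + l : ℤ) : ℝ) * t / T)) := by
    intro t
    have e1 : 2 * π * ((k - l : ℤ) : ℝ) * t / T = 2 * π * k * t / T - 2 * π * l * t / T := by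
      push_cast; ring
    have e2 : 2 * π * ((k + l : ℤ) : ℝ) * t / T = 2 * π * k * t / T + 2 * π * l * t / T := by
      push_cast; ring
    rw [e1, e2, Real.cos_sub, Real.cos_add]; ring
  simp only [e]
  rw [intervalIntegral.integral_const_mul, intervalIntegral.integral_add
      (Continuous.intervalIntegrable (by fun_prop) _ _)
      (Continuous.intervalIntegrable (by fun_prop) _ _), int_cos T hT, int_cos T hT]
  rw [if_neg (show ¬ ((k : ℤ) + l = 0) by omega)]
  by_cases h : k = l
  · simp [h]; ring
  · rw [if_neg (show ¬ ((k : ℤ) - l = 0) by omega), if_neg h]; simp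

lemma int_ss (T : ℝ) (hT : 0 < T) (j k l : ℕ) (hk : 0 < k) :
    ∫ t in (T * j)..(T * j + T), Real.sin (2 * π * k * t / T) * Real.sin (2 * π * l * t / T)
      = if k = l then T / 2 else 0 := by
  have e : ∀ t : ℝ, Real.sin (2 * π * k * t / T) * Real.sin (2 * π * l * t / T)
      = (1 / 2) * (Real.cos (2 * π * ((k - l : ℤ) : ℝ) * t / T)
        - Real.cos (2 * π * ((k + l : ℤ) : ℝ) * t / T)) := by
    intro t
    have e1 : 2 * π * ((k - l : ℤ) : ℝ) * t / T = 2 * π * k * t / T - 2 * π * l * t / T := by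
      push_cast; ring
    have e2 : 2 * π * ((k + l : ℤ) : ℝ) * t / T = 2 * π * k * t / T + 2 * π * l * t / T := by
      push_cast; ring
    rw [e1, e2, Real.cos_sub, Real.cos_add]; ring
  simp only [e]
  rw [intervalIntegral.integral_const_mul, intervalIntegral.integral_sub
      (Continuous.intervalIntegrable (by fun_prop) _ _)
      (Continuous.intervalIntegrable (by fun_prop) _ _), int_cos T hT, int_cos T hT]
  rw [if_neg (show ¬ ((k : ℤ) + l = 0) by omega)]
  by_cases h : k = l
  · simp [h]; ring
  · rw [if_neg (show ¬ ((k : ℤ) - l = 0) by omega), if_neg h]; simp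

lemma int_sc (T : ℝ) (hT : 0 < T) (j k l : ℕ) :
    ∫ t in (T * j)..(T * j + T), Real.sin (2 * π * k * t / T) * Real.cos (2 * π * l * t / T) = 0 := by
  have e : ∀ t : ℝ, Real.sin (2 * π * k * t / T) * Real.cos (2 * π * l * t / T)
      = (1 / 2) * (Real.sin (2 * π * ((k - l : ℤ) : ℝ) * t / T)
        + Real.sin (2 * π * ((k + l : ℤ) : ℝ) * t / T)) := by
    intro t
    have e1 : 2 * π * ((k - l : ℤ) : ℝ) * t / T = 2 * π * k * t / T - 2 * π * l * t / T := by
      push_cast; ring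
    have e2 : 2 * π * ((k + l : ℤ) : ℝ) * t / T = 2 * π * k * t / T + 2 * π * l * t / T := by
      push_cast; ring
    rw [e1, e2, Real.sin_sub, Real.sin_add]; ring
  simp only [e]
  rw [intervalIntegral.integral_const_mul, intervalIntegral.integral_add
      (Continuous.intervalIntegrable (by fun_prop) _ _)
      (Continuous.intervalIntegrable (by fun_prop) _ _), int_sin T hT, int_sin T hT]
  simp

lemma int_c1c (T : ℝ) (hT : 0 < T) (j k l : ℕ) (hk : 0 < k) :
    ∫ t in (T * j)..(T * j + T), Real.cos (2 * π * k * t / T) * (1 - Real.cos (2 * π * l * t / T))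
      = if k = l then -(T / 2) else 0 := by
  simp only [mul_sub, mul_one]
  rw [intervalIntegral.integral_sub
      (Continuous.intervalIntegrable (by fun_prop) _ _)
      (Continuous.intervalIntegrable (by fun_prop) _ _), int_cc T hT _ _ _ hk]
  have := int_cos T hT j k
  rw [if_neg (by omega)] at this
  simp only [Int.cast_natCast] at this
  rw [this]; split_ifs <;> simp

lemma int_s1c (T : ℝ) (hT : 0 < T) (j k l : ℕ) :
    ∫ t in (T * j)..(T * j + T), Real.sin (2 * π * k * t / T) * (1 - Real.cos (2 * π * l * t / T))
      = 0 := by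
  simp only [mul_sub, mul_one]
  rw [intervalIntegral.integral_sub
      (Continuous.intervalIntegrable (by fun_prop) _ _)
      (Continuous.intervalIntegrable (by fun_prop) _ _), int_sc T hT _ _ _]
  have := int_sin T hT j k
  simp only [Int.cast_natCast] at this
  rw [this]; simp

/-- controls -/
def uu {P : Type*} (k : P → ℕ) (α β : P → ℝ) (T : ℝ) : P ⊕ P → ℝ → ℝ
  | Sum.inl p, t => α p * Real.sqrt (4 * π * k p / T) * Real.cos (2 * π * k p * t / T)
  | Sum.inr p, t => β p * Real.sqrt (4 * π * k p / T) * Real.sin (2 * π * k p * t / T)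

/-- primitives of the controls -/
def VV {P : Type*} (k : P → ℕ) (α β : P → ℝ) (T : ℝ) : P ⊕ P → ℝ → ℝ
  | Sum.inl p, t => α p * Real.sqrt (4 * π * k p / T) * (2 * π * k p / T)⁻¹ *
      Real.sin (2 * π * k p * t / T)
  | Sum.inr p, t => β p * Real.sqrt (4 * π * k p / T) * (2 * π * k p / T)⁻¹ *
      (1 - Real.cos (2 * π * k p * t / T))

lemma uu_bound {P : Type*} (k : P → ℕ) (α β : P → ℝ) (T : ℝ) (hT : 0 < T) (A kk : ℝ) (hA : 0 ≤ A)
    (hα : ∀ p, |α p| ≤ A) (hβ : ∀ p, |β p| ≤ A) (hk : ∀ p, (k p : ℝ) ≤ kk) (i : P ⊕ P) (t : ℝ) :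
    |uu k α β T i t| ≤ A * Real.sqrt (4 * π * kk) / Real.sqrt T := by
  have hs : ∀ p, Real.sqrt (4 * π * k p / T) ≤ Real.sqrt (4 * π * kk) / Real.sqrt T := by
    intro p
    rw [← Real.sqrt_div' _ hT.le]
    apply Real.sqrt_le_sqrt
    have := hk p
    gcongr
  rcases i with p | p
  · simp only [uu, abs_mul]
    have h1 := Real.abs_cos_le_one (2 * π * k p * t / T)
    rw [abs_of_nonneg (Real.sqrt_nonneg _), mul_div_assoc A]
    calc _ ≤ |α p| * √(4 * π * ↑(k p) / T) * 1 := by gcongr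
      _ ≤ _ := by rw [mul_one]; exact mul_le_mul (hα p) (hs p) (Real.sqrt_nonneg _) hA
  · simp only [uu, abs_mul]
    have h1 := Real.abs_sin_le_one (2 * π * k p * t / T)
    rw [abs_of_nonneg (Real.sqrt_nonneg _), mul_div_assoc A]
    calc _ ≤ |β p| * √(4 * π * ↑(k p) / T) * 1 := by gcongr
      _ ≤ _ := by rw [mul_one]; exact mul_le_mul (hβ p) (hs p) (Real.sqrt_nonneg _) hA

lemma uu_cont {P : Type*} (k : P → ℕ) (α β : P → ℝ) (T : ℝ) (i : P ⊕ P) :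
    Continuous (uu k α β T i) := by
  rcases i with p | p
  · change Continuous (fun t => α p * Real.sqrt (4 * π * k p / T) * Real.cos (2 * π * k p * t / T))
    fun_prop
  · change Continuous (fun t => β p * Real.sqrt (4 * π * k p / T) * Real.sin (2 * π * k p * t / T))
    fun_prop

lemma VV_deriv {P : Type*} (k : P → ℕ) (α β : P → ℝ) (T : ℝ) (hT : 0 < T) (hk : ∀ p, 0 < k p)
    (i : P ⊕ P) (t : ℝ) :
    HasDerivAt (VV k α β T i) (uu k α β T i t) t := by
  have h1 : ∀ p, HasDerivAt (fun t : ℝ => 2 * π * k p * t / T) (2 * π * k p / T) t := by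
    intro p
    simpa using ((hasDerivAt_id t).const_mul (2 * π * k p)).div_const T
  rcases i with p | p
  · have hc : (0 : ℝ) < k p := by exact_mod_cast hk p
    have h2 := ((h1 p).sin).const_mul (α p * Real.sqrt (4 * π * k p / T) * (2 * π * k p / T)⁻¹)
    change HasDerivAt (fun t => α p * Real.sqrt (4 * π * k p / T) * (2 * π * k p / T)⁻¹ *
      Real.sin (2 * π * k p * t / T)) (α p * Real.sqrt (4 * π * k p / T) * Real.cos (2 * π * k p * t / T)) t
    refine h2.congr_deriv ?_
    field_simp
  · have hc : (0 : ℝ) < k p := by exact_mod_cast hk p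
    have h2 := (((h1 p).cos).const_sub 1).const_mul
      (β p * Real.sqrt (4 * π * k p / T) * (2 * π * k p / T)⁻¹)
    change HasDerivAt (fun t => β p * Real.sqrt (4 * π * k p / T) * (2 * π * k p / T)⁻¹ *
      (1 - Real.cos (2 * π * k p * t / T))) (β p * Real.sqrt (4 * π * k p / T) * Real.sin (2 * π * k p * t / T)) t
    refine h2.congr_deriv ?_
    field_simp

lemma VV_zero {P : Type*} (k : P → ℕ) (α β : P → ℝ) (T : ℝ) (hT : 0 < T) (j : ℕ) (i : P ⊕ P) :
    VV k α β T i (T * j) = 0 ∧ VV k α β T i (T * j + T) = 0 := by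
  rcases i with p | p
  · obtain ⟨h1, h2, h3, h4⟩ := trig_end T hT j (k p)
    simp only [Int.cast_natCast] at h1 h2 h3 h4
    simp [VV, h1, h3]
  · obtain ⟨h1, h2, h3, h4⟩ := trig_end T hT j (k p)
    simp only [Int.cast_natCast] at h1 h2 h3 h4
    simp [VV, h2, h4]

lemma coef_sq (T : ℝ) (hT : 0 < T) (k : ℕ) (hk : 0 < k) :
    Real.sqrt (4 * π * k / T) * (Real.sqrt (4 * π * k / T) * (2 * π * k / T)⁻¹) = 2 := by
  have hc : (0 : ℝ) < k := by exact_mod_cast hk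
  rw [← mul_assoc, Real.mul_self_sqrt (by positivity)]
  field_simp; norm_num

lemma int_uV {P : Type*} [DecidableEq P] (k : P → ℕ) (α β : P → ℝ) (T : ℝ) (hT : 0 < T)
    (hk : ∀ p, 0 < k p) (hinj : Function.Injective k) (j : ℕ) (p q : P) :
    (∫ t in (T * j)..(T * j + T), uu k α β T (Sum.inl p) t * VV k α β T (Sum.inl q) t = 0) ∧
    (∫ t in (T * j)..(T * j + T), uu k α β T (Sum.inr p) t * VV k α β T (Sum.inr q) t = 0) ∧
    (∫ t in (T * j)..(T * j + T), uu k α β T (Sum.inr p) t * VV k α β T (Sum.inl q) t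
      = if p = q then T * (α p * β p) else 0) ∧
    (∫ t in (T * j)..(T * j + T), uu k α β T (Sum.inl p) t * VV k α β T (Sum.inr q) t
      = if p = q then - (T * (α p * β p)) else 0) := by
  simp only [uu, VV]
  refine ⟨?_, ?_, ?_, ?_⟩
  · rw [show (fun t : ℝ => α p * √(4 * π * ↑(k p) / T) * Real.cos (2 * π * ↑(k p) * t / T) *
        (α q * √(4 * π * ↑(k q) / T) * (2 * π * ↑(k q) / T)⁻¹ * Real.sin (2 * π * ↑(k q) * t / T)))
        = fun t => (α p * √(4 * π * ↑(k p) / T) * (α q * √(4 * π * ↑(k q) / T) * (2 * π * ↑(k q) / T)⁻¹)) *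
        (Real.sin (2 * π * ↑(k q) * t / T) * Real.cos (2 * π * ↑(k p) * t / T)) from by ext t; ring]
    rw [intervalIntegral.integral_const_mul, int_sc T hT, mul_zero]
  · rw [show (fun t : ℝ => β p * √(4 * π * ↑(k p) / T) * Real.sin (2 * π * ↑(k p) * t / T) *
        (β q * √(4 * π * ↑(k q) / T) * (2 * π * ↑(k q) / T)⁻¹ * (1 - Real.cos (2 * π * ↑(k q) * t / T))))
        = fun t => (β p * √(4 * π * ↑(k p) / T) * (β q * √(4 * π * ↑(k q) / T) * (2 * π * ↑(k q) / T)⁻¹)) *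
        (Real.sin (2 * π * ↑(k p) * t / T) * (1 - Real.cos (2 * π * ↑(k q) * t / T))) from by ext t; ring]
    rw [intervalIntegral.integral_const_mul, int_s1c T hT, mul_zero]
  · rw [show (fun t : ℝ => β p * √(4 * π * ↑(k p) / T) * Real.sin (2 * π * ↑(k p) * t / T) *
        (α q * √(4 * π * ↑(k q) / T) * (2 * π * ↑(k q) / T)⁻¹ * Real.sin (2 * π * ↑(k q) * t / T)))
        = fun t => (β p * α q * (√(4 * π * ↑(k p) / T) * (√(4 * π * ↑(k q) / T) * (2 * π * ↑(k q) / T)⁻¹))) *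
        (Real.sin (2 * π * ↑(k p) * t / T) * Real.sin (2 * π * ↑(k q) * t / T)) from by ext t; ring]
    rw [intervalIntegral.integral_const_mul, int_ss T hT _ _ _ (hk p)]
    by_cases h : p = q
    · subst h
      rw [coef_sq T hT _ (hk p)]; simp; ring
    · rw [if_neg (fun hh => h (hinj hh)), if_neg h, mul_zero]
  · rw [show (fun t : ℝ => α p * √(4 * π * ↑(k p) / T) * Real.cos (2 * π * ↑(k p) * t / T) *
        (β q * √(4 * π * ↑(k q) / T) * (2 * π * ↑(k q) / T)⁻¹ * (1 - Real.cos (2 * π * ↑(k q) * t / T))))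
        = fun t => (α p * β q * (√(4 * π * ↑(k p) / T) * (√(4 * π * ↑(k q) / T) * (2 * π * ↑(k q) / T)⁻¹))) *
        (Real.cos (2 * π * ↑(k p) * t / T) * (1 - Real.cos (2 * π * ↑(k q) * t / T))) from by ext t; ring]
    rw [intervalIntegral.integral_const_mul, int_c1c T hT _ _ _ (hk p)]
    by_cases h : p = q
    · subst h
      rw [coef_sq T hT _ (hk p)]; simp; ring
    · rw [if_neg (fun hh => h (hinj hh)), if_neg h, mul_zero]

/-- One-period averaging. -/
lemma avg {E : Type*} [NormedAddCommGroup E] [NormedSpace ℝ E]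
    {P : Type*} [Fintype P] (k : P → ℕ) (α β : P → ℝ)
    (h : P ⊕ P → E → E) (h' : P ⊕ P → E →L[ℝ] E)
    (y e : ℝ → E) (b : E) (T U L η Δ B₀ E₀ : ℝ) (j : ℕ)
    (hT : 0 < T) (hU : 0 ≤ U) (hη : 0 ≤ η) (hk : ∀ p, 0 < k p) (hinj : Function.Injective k)
    (huU : ∀ i t, |uu k α β T i t| ≤ U)
    (hy : ContinuousOn y (Icc (T * j) (T * j + T)))
    (hy' : ∀ t ∈ Ico (T * j) (T * j + T),
      HasDerivWithinAt y (b + e t + ∑ i, uu k α β T i t • h i (y t)) (Ici t) t)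
    (he : ∀ t ∈ Ico (T * j) (T * j + T), ‖e t‖ ≤ E₀) (hb : ‖b‖ ≤ B₀)
    (hΔ : ∀ t ∈ Icc (T * j) (T * j + T), ‖y t - y (T * j)‖ ≤ Δ)
    (hmod : ∀ i z, ‖z - y (T * j)‖ ≤ Δ →
      ‖h i z - h i (y (T * j)) - h' i (z - y (T * j))‖ ≤ η * ‖z - y (T * j)‖)
    (hL : ∀ i, ‖h' i‖ ≤ L) (hL0 : 0 ≤ L) :
    ‖y (T * j + T) - y (T * j) - T • (b + ∑ p, (α p * β p) •
        (h' (Sum.inr p) (h (Sum.inl p) (y (T * j))) - h' (Sum.inl p) (h (Sum.inr p) (y (T * j)))))‖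
      ≤ T * (E₀ + Fintype.card (P ⊕ P) * (U * (η * Δ +
          L * (T * (B₀ + E₀ + Fintype.card (P ⊕ P) * (U * ((L + η) * Δ))))))) := by
  classical
  have key := expand2 (uu k α β T) (VV k α β T) h h' y e b (T * j) T U L η Δ B₀ E₀ hT hU hη
    (uu_cont k α β T) (VV_deriv k α β T hT hk) (fun i => (VV_zero k α β T hT j i).1) huU hy hy'
    he hb hΔ hmod hL hL0
  convert key using 2
  simp only [(VV_zero k α β T hT j _).2, zero_smul, Finset.sum_const_zero, sub_zero]
  rw [smul_add, ← sub_sub]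
  congr 1
  simp only [Fintype.sum_sum_type]
  simp only [fun p q => (int_uV k α β T hT hk hinj j p q).1,
    fun p q => (int_uV k α β T hT hk hinj j p q).2.1,
    fun p q => (int_uV k α β T hT hk hinj j p q).2.2.1,
    fun p q => (int_uV k α β T hT hk hinj j p q).2.2.2, ite_smul, zero_smul,
    Finset.sum_ite_eq, Finset.sum_const_zero, zero_add, add_zero, Finset.mem_univ, if_true]
  rw [← Finset.sum_add_distrib, Finset.smul_sum]
  refine Finset.sum_congr rfl fun p _ => ?_
  simp only [smul_sub, mul_smul, neg_smul]
  abel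

end Trig

section Fam

lemma fam_mod {E F : Type*} [NormedAddCommGroup E] [NormedSpace ℝ E] [ProperSpace E]
    [NormedAddCommGroup F] [NormedSpace ℝ F] {ι : Type*} [Fintype ι]
    {D K : Set E} (hD : IsOpen D) (hK : IsCompact K)
    (hKD : K ⊆ D) {h : ι → E → F} (hh : ∀ i, ContDiffOn ℝ 2 (h i) D) {η : ℝ} (hη : 0 < η) :
    ∃ d > 0, ∀ i, ∀ x ∈ K, ∀ y, ‖y - x‖ ≤ d →
      ‖h i y - h i x - fderiv ℝ (h i) x (y - x)‖ ≤ η * ‖y - x‖ := by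
  choose d hd hd' using fun i => unif_diff hD hK hKD (hh i) hη
  obtain ⟨d0, hd0, hle⟩ : ∃ d0 > 0, ∀ i, d0 ≤ d i := by
    rcases isEmpty_or_nonempty ι with h0 | h0
    · exact ⟨1, one_pos, fun i => (h0.false i).elim⟩
    · obtain ⟨i, hi⟩ := Finite.exists_min d
      exact ⟨d i, hd i, hi⟩
  exact ⟨d0, hd0, fun i x hx y hxy => hd' i x hx y (hxy.trans (hle i))⟩

lemma fam_bd {E F : Type*} [TopologicalSpace E] [NormedAddCommGroup F]
    {ι : Type*} [Fintype ι] {K : Set E} (hK : IsCompact K)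
    {h : ι → E → F} (hh : ∀ i, ContinuousOn (h i) K) :
    ∃ M, 0 ≤ M ∧ ∀ i, ∀ x ∈ K, ‖h i x‖ ≤ M := by
  choose C hC using fun i => hK.exists_bound_of_continuousOn (hh i)
  refine ⟨∑ i, |C i|, Finset.sum_nonneg fun i _ => abs_nonneg _, fun i x hx => ?_⟩
  refine ((hC i x hx).trans (le_abs_self _)).trans ?_
  exact Finset.single_le_sum (f := fun i => |C i|) (fun i _ => abs_nonneg _) (Finset.mem_univ i)

lemma total_small (N Uc C L B₀ θ : ℝ) (hN : 0 ≤ N) (hUc : 0 ≤ Uc) (hC : 0 ≤ C) (hL : 0 ≤ L)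
    (hB₀ : 0 ≤ B₀) (hθ : 0 < θ) :
    ∃ η₁ > 0, η₁ ≤ 1 ∧ ∃ sb > 0, ∀ T, 0 < T → Real.sqrt T ≤ sb → ∀ E₀, 0 ≤ E₀ → E₀ ≤ 1 →
      E₀ ≤ θ / 4 →
      E₀ + N * ((Uc / Real.sqrt T) * (η₁ * (C * Real.sqrt T) + L * (T * (B₀ + E₀ +
        N * ((Uc / Real.sqrt T) * ((L + η₁) * (C * Real.sqrt T))))))) ≤ θ := by
  set Q := N * Uc * L * (B₀ + 1 + N * Uc * (L + 1) * C) with hQ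
  have hQ0 : 0 ≤ Q := by positivity
  have hR0 : 0 ≤ N * Uc * C := by positivity
  refine ⟨min 1 (θ / (4 * (N * Uc * C + 1))), lt_min one_pos (by positivity), min_le_left _ _,
    θ / (4 * (Q + 1)), by positivity, fun T hT hs E₀ hE0 hE1 hEθ => ?_⟩
  set η₁ := min 1 (θ / (4 * (N * Uc * C + 1)))
  have h1 : η₁ ≤ 1 := min_le_left _ _
  have h10 : 0 < η₁ := lt_min one_pos (by positivity)
  have h2 : η₁ ≤ (θ / (4 * (N * Uc * C + 1))) := min_le_right _ _
  have hsT : 0 < Real.sqrt T := Real.sqrt_pos.2 hT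
  set s := Real.sqrt T
  have hTs : T = s * s := (Real.mul_self_sqrt hT.le).symm
  have e : E₀ + N * ((Uc / s) * (η₁ * (C * s) + L * (T * (B₀ + E₀ +
        N * ((Uc / s) * ((L + η₁) * (C * s)))))))
      = E₀ + N * Uc * C * η₁ + s * (N * Uc * L * (B₀ + E₀ + N * Uc * (L + η₁) * C)) := by
    rw [hTs]; field_simp; ring
  rw [e]
  have h3 : N * Uc * C * η₁ ≤ θ / 4 := by
    rw [le_div_iff₀ (by positivity)] at h2
    nlinarith
  have h4 : N * Uc * L * (B₀ + E₀ + N * Uc * (L + η₁) * C) ≤ Q := by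
    rw [hQ]; gcongr
  have h5 : s * (N * Uc * L * (B₀ + E₀ + N * Uc * (L + η₁) * C)) ≤ s * Q := by gcongr
  rw [le_div_iff₀ (by positivity)] at hs
  nlinarith

end Fam

section XStep

lemma Fmat_mulVec {n m : ℕ} (f : Fin m → EuclideanSpace ℝ (Fin n) → EuclideanSpace ℝ (Fin n))
    (S₁ : Finset (Fin m)) (S₂ : Finset (Fin m × Fin m)) (idx : (↥S₁ ⊕ ↥S₂) ≃ Fin n)
    (x : EuclideanSpace ℝ (Fin n)) (a : Fin n → ℝ) (i : Fin n) :
    (Fmat f S₁ S₂ idx x *ᵥ a) i = (∑ j, a j • col f S₁ S₂ idx x j) i := by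
  simp [Matrix.mulVec, dotProduct, Fmat, mul_comm]

lemma Fmat_unit {n m : ℕ} (f : Fin m → EuclideanSpace ℝ (Fin n) → EuclideanSpace ℝ (Fin n))
    (S₁ : Finset (Fin m)) (S₂ : Finset (Fin m × Fin m)) (idx : (↥S₁ ⊕ ↥S₂) ≃ Fin n)
    (x : EuclideanSpace ℝ (Fin n))
    (hr : Submodule.span ℝ (Set.range fun j => col f S₁ S₂ idx x j) = ⊤) :
    IsUnit (Fmat f S₁ S₂ idx x) := by
  rw [← Matrix.mulVec_surjective_iff_isUnit]
  intro v
  have hv : (WithLp.toLp 2 v : EuclideanSpace ℝ (Fin n)) ∈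
      Submodule.span ℝ (Set.range fun j => col f S₁ S₂ idx x j) := by rw [hr]; trivial
  rw [Submodule.mem_span_range_iff_exists_fun] at hv
  obtain ⟨c, hc⟩ := hv
  refine ⟨c, ?_⟩
  ext i
  rw [Fmat_mulVec, hc]

lemma avec_sum {n m : ℕ} (f : Fin m → EuclideanSpace ℝ (Fin n) → EuclideanSpace ℝ (Fin n))
    (S₁ : Finset (Fin m)) (S₂ : Finset (Fin m × Fin m)) (idx : (↥S₁ ⊕ ↥S₂) ≃ Fin n)
    (x ξ : EuclideanSpace ℝ (Fin n)) (γ₁ : ℝ)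
    (hr : Submodule.span ℝ (Set.range fun j => col f S₁ S₂ idx x j) = ⊤) :
    (∑ i₁ : S₁, avec f S₁ S₂ idx γ₁ x ξ (idx (Sum.inl i₁)) • f i₁ x)
      + ∑ p : S₂, avec f S₁ S₂ idx γ₁ x ξ (idx (Sum.inr p)) • lieBracket (f p.1.1) (f p.1.2) x
      = -(γ₁ • (x - ξ)) := by
  have h1 : ∑ j, avec f S₁ S₂ idx γ₁ x ξ j • col f S₁ S₂ idx x j = -(γ₁ • (x - ξ)) := by
    ext i
    rw [← Fmat_mulVec, avec, Matrix.mulVec_smul, Matrix.mulVec_mulVec,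
      Matrix.mul_nonsing_inv _ ((Matrix.isUnit_iff_isUnit_det _).1 (Fmat_unit f S₁ S₂ idx x hr))]
    simp
  rw [← h1, ← idx.sum_comp, Fintype.sum_sum_type]
  simp [_root_.col]

lemma avec_bd {n m : ℕ} (f : Fin m → EuclideanSpace ℝ (Fin n) → EuclideanSpace ℝ (Fin n))
    (S₁ : Finset (Fin m)) (S₂ : Finset (Fin m × Fin m)) (idx : (↥S₁ ⊕ ↥S₂) ≃ Fin n)
    (x ξ : EuclideanSpace ℝ (Fin n)) (γ₁ α : ℝ) (hγ : 0 ≤ γ₁)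
    (hFinv : ∀ v : EuclideanSpace ℝ (Fin n),
      ‖((WithLp.equiv 2 (Fin n → ℝ)).symm ((Fmat f S₁ S₂ idx x)⁻¹ *ᵥ (fun i => v i)))‖ ≤ α * ‖v‖)
    (j : Fin n) :
    |avec f S₁ S₂ idx γ₁ x ξ j| ≤ γ₁ * (α * ‖x - ξ‖) := by
  have h1 := hFinv (x - ξ)
  have h2 := PiLp.norm_apply_le ((WithLp.equiv 2 (Fin n → ℝ)).symm
    ((Fmat f S₁ S₂ idx x)⁻¹ *ᵥ (fun i => (x - ξ) i))) j
  have h3 : avec f S₁ S₂ idx γ₁ x ξ j = -γ₁ * ((WithLp.equiv 2 (Fin n → ℝ)).symm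
    ((Fmat f S₁ S₂ idx x)⁻¹ *ᵥ (fun i => (x - ξ) i))) j := by
    simp [avec]
  rw [h3, abs_mul, abs_neg, abs_of_nonneg hγ]
  exact mul_le_mul_of_nonneg_left (h2.trans h1) hγ

lemma ctrl_sum {n m : ℕ} (f : Fin m → EuclideanSpace ℝ (Fin n) → EuclideanSpace ℝ (Fin n))
    (S₁ : Finset (Fin m)) (S₂ : Finset (Fin m × Fin m)) (idx : (↥S₁ ⊕ ↥S₂) ≃ Fin n)
    (κ : Fin m × Fin m → ℕ) (γ₁ ε : ℝ) (hε : 0 < ε) (x ξ y : EuclideanSpace ℝ (Fin n)) (t : ℝ) :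
    ∑ i : Fin m, ctrl f S₁ S₂ idx κ γ₁ ε x ξ i t • f i y =
      (∑ i₁ : S₁, avec f S₁ S₂ idx γ₁ x ξ (idx (Sum.inl i₁)) • f i₁ y)
      + ∑ i : S₂ ⊕ S₂, uu (fun p : S₂ => κ p.1)
        (fun p => Real.sign (avec f S₁ S₂ idx γ₁ x ξ (idx (Sum.inr p))) *
          Real.sqrt |avec f S₁ S₂ idx γ₁ x ξ (idx (Sum.inr p))|)
        (fun p => Real.sqrt |avec f S₁ S₂ idx γ₁ x ξ (idx (Sum.inr p))|) ε i t •
          (Sum.elim (fun p : S₂ => f p.1.1) (fun p : S₂ => f p.1.2) i) y := by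
  have hsq : ∀ p : S₂, Real.sqrt (4 * π / ε) *
      Real.sqrt (κ p.1 * |avec f S₁ S₂ idx γ₁ x ξ (idx (Sum.inr p))|)
      = Real.sqrt |avec f S₁ S₂ idx γ₁ x ξ (idx (Sum.inr p))| * Real.sqrt (4 * π * κ p.1 / ε) := by
    intro p
    rw [← Real.sqrt_mul (by positivity), ← Real.sqrt_mul (by positivity)]
    congr 1; ring
  simp only [ctrl, add_smul, Finset.sum_add_distrib]
  congr 1
  · simp only [Finset.sum_smul]
    rw [Finset.sum_comm]
    simp only [Finset.univ_eq_attach]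
    refine Finset.sum_congr rfl fun i₁ _ => ?_
    simp [ite_smul]
  · simp only [Fintype.sum_sum_type, uu, Sum.elim_inl, Sum.elim_inr]
    rw [← Finset.sum_add_distrib]
    simp only [Finset.mul_sum, Finset.sum_smul]
    rw [Finset.sum_comm]
    simp only [Finset.univ_eq_attach]
    refine Finset.sum_congr rfl fun p _ => ?_
    simp only [← mul_assoc, hsq]
    simp only [mul_add, add_smul, Finset.sum_add_distrib]
    congr 1
    · rw [Finset.sum_eq_single p.1.1]
      · simp; congr 1; ring
      · intro i _ hi; simp [hi]
      · simp
    · rw [Finset.sum_eq_single p.1.2]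
      · simp
      · intro i _ hi; simp [hi]
      · simp

end XStep

section XStep2

lemma sign_mul_abs' (r : ℝ) : Real.sign r * |r| = r := by
  rcases lt_trichotomy r 0 with h | h | h
  · rw [Real.sign_of_neg h, abs_of_neg h]; ring
  · simp [h]
  · rw [Real.sign_of_pos h, abs_of_pos h]; ring

set_option maxHeartbeats 1000000 in
lemma xstep {n m : ℕ} (f : Fin m → EuclideanSpace ℝ (Fin n) → EuclideanSpace ℝ (Fin n))
    (S₁ : Finset (Fin m)) (S₂ : Finset (Fin m × Fin m)) (idx : (↥S₁ ⊕ ↥S₂) ≃ Fin n)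
    (D K : Set (EuclideanSpace ℝ (Fin n))) (hD : IsOpen D) (hK : IsCompact K) (hKD : K ⊆ D)
    (hf_smooth : ∀ i, ContDiffOn ℝ 2 (f i) D)
    (hrank : ∀ x ∈ D, Submodule.span ℝ (Set.range fun j => col f S₁ S₂ idx x j) = ⊤)
    (α : ℝ) (hα : 0 < α)
    (hFinv : ∀ x ∈ D, ∀ v : EuclideanSpace ℝ (Fin n),
      ‖((WithLp.equiv 2 (Fin n → ℝ)).symm ((Fmat f S₁ S₂ idx x)⁻¹ *ᵥ (fun i => v i)))‖ ≤ α * ‖v‖)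
    (κ : Fin m × Fin m → ℕ) (hκpos : ∀ p ∈ S₂, 0 < κ p) (hκinj : Set.InjOn κ S₂)
    (γ₁ η θ : ℝ) (hγ : 0 < γ₁) (hη : 0 < η) (hθ : 0 < θ) :
    ∃ εb > 0, ∀ ε ∈ Set.Ioc (0:ℝ) εb, ∀ (j : ℕ) (x : ℝ → EuclideanSpace ℝ (Fin n))
      (ξ0 : EuclideanSpace ℝ (Fin n)), x (ε * j) ∈ K → ‖x (ε * j) - ξ0‖ ≤ η →
      ContinuousOn x (Icc (ε * j) (ε * j + ε)) →
      (∀ t ∈ Ico (ε * j) (ε * j + ε), HasDerivWithinAt x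
        (∑ i : Fin m, ctrl f S₁ S₂ idx κ γ₁ ε (x (ε * j)) ξ0 i t • f i (x t)) (Ici t) t) →
      (∀ t ∈ Icc (ε * j) (ε * j + ε), ‖x t - x (ε * j)‖ ≤ θ) ∧
      ‖x (ε * j + ε) - x (ε * j) + (ε * γ₁) • (x (ε * j) - ξ0)‖ ≤ ε * θ := by
  obtain ⟨M0, hM0, hM⟩ := fam_bd hK (h := f) (fun i => (hf_smooth i).continuousOn.mono hKD)
  obtain ⟨L, hL0, hL⟩ := fam_bd hK (h := fun i => fderiv ℝ (f i))
    (fun i => ((hf_smooth i).continuousOn_fderiv_of_isOpen hD (by norm_num)).mono hKD)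
  obtain ⟨d1, hd1, hmod1⟩ := fam_mod hD hK hKD hf_smooth one_pos
  set A0 : ℝ := γ₁ * (α * η) with hA0
  have hA0p : 0 < A0 := by positivity
  set kk : ℝ := ∑ p ∈ S₂, (κ p : ℝ) with hkk
  have hkk0 : 0 ≤ kk := Finset.sum_nonneg fun _ _ => Nat.cast_nonneg _
  set Uc : ℝ := Real.sqrt A0 * Real.sqrt (4 * π * kk) with hUc
  have hUc0 : 0 ≤ Uc := by positivity
  set N : ℝ := (Fintype.card (S₂ ⊕ S₂) : ℝ) with hN
  set s₁ : ℝ := (Fintype.card S₁ : ℝ) with hs1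
  set M : ℝ := M0 + (L + 1) with hMdef
  have hM0' : 0 ≤ M := by positivity
  set C : ℝ := s₁ * (A0 * M) + N * (Uc * M) + 1 with hC
  have hC0 : 0 ≤ C := by positivity
  obtain ⟨η₁, hη1, hη11, sb, hsb, htot⟩ := total_small N Uc C L (s₁ * (A0 * M0)) θ
    (by positivity) hUc0 hC0 hL0 (by positivity) hθ
  obtain ⟨d2, hd2, hmod2⟩ := fam_mod hD hK hKD hf_smooth hη1
  -- threshold for sqrt ε
  set Ec : ℝ := s₁ * (A0 * ((L + 1) * C)) with hEc
  have hEc0 : 0 ≤ Ec := by positivity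
  obtain ⟨w, hwp, hw1, hw2, hw3, hw4, hw5⟩ : ∃ w : ℝ, 0 < w ∧ w ≤ d1 ∧ w ≤ 1 ∧ w ≤ d2 ∧ w ≤ θ ∧
      w ≤ θ / 4 := by
    refine ⟨min d1 (min 1 (min d2 (min θ (θ / 4)))), by positivity, ?_⟩
    simp
  obtain ⟨r, hrp, hr1, hr2, hr3⟩ : ∃ r : ℝ, 0 < r ∧ r ≤ sb ∧ r ≤ 1 ∧ r ≤ w / (C + Ec + 1) := by
    refine ⟨min sb (min 1 (w / (C + Ec + 1))), by positivity, ?_⟩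
    simp
  refine ⟨r ^ 2, by positivity, fun ε hε j x ξ0 hxK hxξ hxc hxd => ?_⟩
  have hε0 : 0 < ε := hε.1
  have hs0 : 0 < Real.sqrt ε := Real.sqrt_pos.2 hε0
  have hsr : Real.sqrt ε ≤ r := by
    rw [← Real.sqrt_sq hrp.le]; exact Real.sqrt_le_sqrt hε.2
  have hss : Real.sqrt ε * Real.sqrt ε = ε := Real.mul_self_sqrt hε0.le
  set s := Real.sqrt ε with hs
  have hs_sb : s ≤ sb := hsr.trans hr1
  have hs_1 : s ≤ 1 := hsr.trans hr2
  have hs_w : s * (C + Ec + 1) ≤ w := by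
    have := hsr.trans hr3
    rwa [le_div_iff₀ (by positivity)] at this
  have hsC0 := mul_nonneg hs0.le hC0
  have hsE0 := mul_nonneg hs0.le hEc0
  have hCs : C * s ≤ w := by linarith
  have hEs : Ec * s ≤ w := by linarith
  set x₀ := x (ε * j) with hx0
  have hxD : x₀ ∈ D := hKD hxK
  set a := avec f S₁ S₂ idx γ₁ x₀ ξ0 with ha
  have haA : ∀ j, |a j| ≤ A0 := by
    intro j
    refine (avec_bd f S₁ S₂ idx x₀ ξ0 γ₁ α hγ.le (hFinv x₀ hxD) j).trans ?_
    rw [hA0]; gcongr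
  set kf : S₂ → ℕ := fun p => κ p.1 with hkf
  set αf : S₂ → ℝ := fun p => Real.sign (a (idx (Sum.inr p))) * Real.sqrt |a (idx (Sum.inr p))|
  set βf : S₂ → ℝ := fun p => Real.sqrt |a (idx (Sum.inr p))|
  set h : S₂ ⊕ S₂ → EuclideanSpace ℝ (Fin n) → EuclideanSpace ℝ (Fin n) :=
    Sum.elim (fun p : S₂ => f p.1.1) (fun p : S₂ => f p.1.2) with hh
  have hhi : ∀ i, ∃ q, h i = f q := by
    rintro (p | p)
    · exact ⟨p.1.1, rfl⟩
    · exact ⟨p.1.2, rfl⟩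
  have hβA : ∀ p, |βf p| ≤ Real.sqrt A0 := by
    intro p
    rw [abs_of_nonneg (Real.sqrt_nonneg _)]
    exact Real.sqrt_le_sqrt (haA _)
  have hαA : ∀ p, |αf p| ≤ Real.sqrt A0 := by
    intro p
    have h1 : |Real.sign (a (idx (Sum.inr p)))| ≤ 1 := by
      rcases Real.sign_apply_eq (a (idx (Sum.inr p))) with h | h | h <;> rw [h] <;> simp
    have h2 := hβA p
    simp only [αf, abs_mul]
    simp only [βf] at h2
    exact (mul_le_of_le_one_left (abs_nonneg _) h1).trans h2
  have hkkb : ∀ p, (kf p : ℝ) ≤ kk := by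
    intro p
    exact Finset.single_le_sum (f := fun p => (κ p : ℝ)) (fun _ _ => Nat.cast_nonneg _) p.2
  have huU : ∀ i t, |uu kf αf βf ε i t| ≤ Uc / s := fun i t =>
    uu_bound kf αf βf ε hε0 (Real.sqrt A0) kk (Real.sqrt_nonneg _) hαA hβA hkkb i t
  have hUs : 0 ≤ Uc / s := by positivity
  set b : EuclideanSpace ℝ (Fin n) := ∑ i₁ : S₁, a (idx (Sum.inl i₁)) • f i₁ x₀ with hb
  set e : ℝ → EuclideanSpace ℝ (Fin n) := fun t =>
    ∑ i₁ : S₁, a (idx (Sum.inl i₁)) • (f i₁ (x t) - f i₁ x₀) with he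
  have hder : ∀ t ∈ Ico (ε * j) (ε * j + ε), HasDerivWithinAt x
      (b + e t + ∑ i, uu kf αf βf ε i t • h i (x t)) (Ici t) t := by
    intro t ht
    have h1 := hxd t ht
    rw [ctrl_sum f S₁ S₂ idx κ γ₁ ε hε0 x₀ ξ0 (x t) t] at h1
    convert h1 using 2
    simp only [hb, he, ← Finset.sum_add_distrib, ← smul_add]
    refine Finset.sum_congr rfl fun i _ => ?_
    congr 1; abel
  have hinc : ∀ z, ‖z - x₀‖ ≤ d1 → ∀ i, ‖f i z - f i x₀‖ ≤ (L + 1) * ‖z - x₀‖ := by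
    intro z hz i
    have h1 := hmod1 i x₀ hxK z hz
    have h2 : ‖fderiv ℝ (f i) x₀ (z - x₀)‖ ≤ L * ‖z - x₀‖ :=
      (fderiv ℝ (f i) x₀).le_of_opNorm_le (hL i x₀ hxK) _
    have h3 : f i z - f i x₀ = (f i z - f i x₀ - fderiv ℝ (f i) x₀ (z - x₀))
      + fderiv ℝ (f i) x₀ (z - x₀) := by abel
    rw [h3]
    refine (norm_add_le _ _).trans ?_
    linarith
  have hdisp : ∀ t ∈ Icc (ε * j) (ε * j + ε), ‖x t - x₀‖ ≤ C / s * (t - ε * j) := by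
    refine disp_bound (d := w) (C' := (C - 1) / s) hxc hder ?_ ?_ (by positivity) ?_
    · intro t ht hxt
      have hfz : ∀ i, ‖f i (x t)‖ ≤ M := by
        intro i
        have h1 := hinc (x t) (hxt.trans hw1) i
        have h2 : f i (x t) = f i x₀ + (f i (x t) - f i x₀) := by abel
        rw [h2]
        refine (norm_add_le _ _).trans ?_
        have h3 := hM i x₀ hxK
        have h4 : (L + 1) * ‖x t - x₀‖ ≤ (L + 1) * 1 :=
          mul_le_mul_of_nonneg_left (hxt.trans hw2) (by positivity)
        rw [hMdef]; linarith
      have hbe : b + e t = ∑ i₁ : S₁, a (idx (Sum.inl i₁)) • f i₁ (x t) := by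
        simp only [hb, he, ← Finset.sum_add_distrib, ← smul_add]
        refine Finset.sum_congr rfl fun i _ => ?_
        congr 1; abel
      rw [hbe]
      have h1 := norm_sum_smul_le (fun i₁ : S₁ => a (idx (Sum.inl i₁))) (fun i₁ => f i₁ (x t))
        hA0p.le (fun i => haA _) (fun i => hfz _)
      have h2 := norm_sum_smul_le (fun i => uu kf αf βf ε i t) (fun i => h i (x t))
        hUs (fun i => huU i t) (W := M) (fun i => by
          obtain ⟨q, hq⟩ := hhi i
          rw [hq]; exact hfz q)
      refine (norm_add_le _ _).trans ((add_le_add h1 h2).trans ?_)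
      have h5 : s₁ * (A0 * M) ≤ s₁ * (A0 * M) / s := by
        rw [le_div_iff₀ hs0]
        have : 0 ≤ s₁ * (A0 * M) := by positivity
        exact mul_le_of_le_one_right this hs_1
      have h6 : (C - 1) / s = s₁ * (A0 * M) / s + N * (Uc / s * M) := by
        rw [hC]; field_simp; ring
      rw [h6]
      linarith
    · gcongr; linarith
    · rw [add_sub_cancel_left]
      calc C / s * ε = C * s := by rw [← hss]; field_simp
        _ ≤ w := hCs
  have hdisp' : ∀ t ∈ Icc (ε * j) (ε * j + ε), ‖x t - x₀‖ ≤ C * s := by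
    intro t ht
    refine (hdisp t ht).trans ?_
    calc C / s * (t - ε * j) ≤ C / s * ε := by
          gcongr; linarith [ht.2]
      _ = C * s := by rw [← hss]; field_simp
  refine ⟨fun t ht => (hdisp' t ht).trans (hCs.trans hw4), ?_⟩
  have heb : ∀ t ∈ Ico (ε * j) (ε * j + ε), ‖e t‖ ≤ Ec * s := by
    intro t ht
    have h1 := hdisp' t ⟨ht.1, ht.2.le⟩
    have h2 := norm_sum_smul_le (fun i₁ : S₁ => a (idx (Sum.inl i₁)))
      (fun i₁ => f i₁ (x t) - f i₁ x₀) hA0p.le (fun i => haA _) (W := (L + 1) * (C * s))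
      (fun i => (hinc (x t) (h1.trans (hCs.trans hw1)) i).trans
        (mul_le_mul_of_nonneg_left h1 (by positivity)))
    refine h2.trans (le_of_eq ?_)
    rw [hEc]; ring
  have hbb : ‖b‖ ≤ s₁ * (A0 * M0) :=
    norm_sum_smul_le (fun i₁ : S₁ => a (idx (Sum.inl i₁))) (fun i₁ => f i₁ x₀)
        hA0p.le (fun i => haA _) (fun i => hM _ _ hxK)
  have key := avg kf αf βf h (fun i => fderiv ℝ (h i) x₀) x e b ε (Uc / s) L η₁ (C * s)
    (s₁ * (A0 * M0)) (Ec * s) j hε0 hUs hη1.le (fun p => hκpos _ p.2)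
    (fun p q hpq => Subtype.ext (hκinj p.2 q.2 hpq)) huU hxc hder heb hbb hdisp'
    (fun i z hz => by
      obtain ⟨q, hq⟩ := hhi i
      simp only [hq]
      exact hmod2 q x₀ hxK z (hz.trans (hCs.trans hw3)))
    (fun i => by
      obtain ⟨q, hq⟩ := hhi i
      simp only [hq]
      exact hL q x₀ hxK) hL0
  have hfin := htot ε hε0 hs_sb (Ec * s) (by positivity) (hEs.trans hw2) (hEs.trans hw5)
  have hmain : b + ∑ p, (αf p * βf p) • (fderiv ℝ (h (Sum.inr p)) x₀ (h (Sum.inl p) x₀)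
      - fderiv ℝ (h (Sum.inl p)) x₀ (h (Sum.inr p) x₀)) = -(γ₁ • (x₀ - ξ0)) := by
    rw [← avec_sum f S₁ S₂ idx x₀ ξ0 γ₁ (hrank x₀ hxD)]
    congr 1
    refine Finset.sum_congr rfl fun p _ => ?_
    have : αf p * βf p = a (idx (Sum.inr p)) := by
      simp only [αf, βf]
      rw [mul_assoc, Real.mul_self_sqrt (abs_nonneg _), sign_mul_abs']
    rw [this]
    rfl
  rw [hmain] at key
  have e1 : x (ε * j + ε) - x₀ + (ε * γ₁) • (x₀ - ξ0)
      = x (ε * j + ε) - x₀ - ε • (-(γ₁ • (x₀ - ξ0))) := by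
    rw [mul_smul, smul_neg, sub_neg_eq_add]
  rw [e1]
  refine key.trans ?_
  exact mul_le_mul_of_nonneg_left hfin hε0.le

end XStep2

section XiStep

lemma diff_of_comp {E : Type*} [NormedAddCommGroup E] [NormedSpace ℝ E] {J : E → ℝ} {g : ℝ → ℝ}
    {y : E} (hJ : ContDiffAt ℝ 2 J y) (hne : fderiv ℝ J y ≠ 0)
    (hg : DifferentiableAt ℝ (fun x => g (J x)) y) : DifferentiableAt ℝ g (J y) := by
  obtain ⟨v, hv⟩ : ∃ v, fderiv ℝ J y v ≠ 0 := by
    by_contra hcon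
    push Not at hcon
    exact hne (ContinuousLinearMap.ext hcon)
  have hJs : HasStrictFDerivAt J (fderiv ℝ J y) y := hJ.hasStrictFDerivAt (by norm_num)
  have hl : HasStrictDerivAt (fun t : ℝ => y + t • v) v 0 := by
    have := ((hasStrictDerivAt_id (0 : ℝ)).smul_const v).const_add y
    simpa using this
  have hφ : HasStrictDerivAt (fun t : ℝ => J (y + t • v)) (fderiv ℝ J y v) 0 := by
    have hJs' : HasStrictFDerivAt J (fderiv ℝ J y) (y + (0 : ℝ) • v) := by simpa using hJs
    exact hJs'.comp_hasStrictDerivAt 0 hl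
  set φ : ℝ → ℝ := fun t : ℝ => J (y + t • v) with hφd
  have hφ0 : φ 0 = J y := by simp [hφd]
  have hψ := hφ.to_localInverse hv
  set ψ := hφ.localInverse φ (fderiv ℝ J y v) 0 hv with hψd
  have hψ0 : ψ (φ 0) = 0 := HasStrictFDerivAt.localInverse_apply_image _
  have hr : ∀ᶠ z in nhds (φ 0), φ (ψ z) = z :=
    HasStrictFDerivAt.eventually_right_inverse (hφ.hasStrictFDerivAt_equiv hv)
  rw [← hφ0]
  have hcomp : DifferentiableAt ℝ (fun z => g (J (y + ψ z • v))) (φ 0) := by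
    have h1 : DifferentiableAt ℝ (fun z => y + ψ z • v) (φ 0) :=
      (hψ.hasDerivAt.differentiableAt.smul_const v).const_add y
    have h2 : DifferentiableAt ℝ (fun x => g (J x)) ((fun z => y + ψ z • v) (φ 0)) := by
      simpa [hψ0] using hg
    exact DifferentiableAt.comp (g := fun x => g (J x)) (f := fun z => y + ψ z • v) (φ 0) h2 h1
  refine hcomp.congr_of_eventuallyEq ?_
  filter_upwards [hr] with z hz
  conv_lhs => rw [← hz]

lemma Gfield_norm {n : ℕ} (g : Fin n ⊕ Fin n → ℝ → ℝ) (J : EuclideanSpace ℝ (Fin n) → ℝ)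
    (j : Fin n ⊕ Fin n) (x : EuclideanSpace ℝ (Fin n)) : ‖Gfield g J j x‖ = |g j (J x)| := by
  simp [Gfield, norm_smul]

lemma Gfield_sub_norm {n : ℕ} (g : Fin n ⊕ Fin n → ℝ → ℝ) (J : EuclideanSpace ℝ (Fin n) → ℝ)
    (j : Fin n ⊕ Fin n) (x y : EuclideanSpace ℝ (Fin n)) :
    ‖Gfield g J j x - Gfield g J j y‖ = |g j (J x) - g j (J y)| := by
  simp [Gfield, ← sub_smul, norm_smul]

lemma Gfield_fderiv {n : ℕ} (g : Fin n ⊕ Fin n → ℝ → ℝ) (J : EuclideanSpace ℝ (Fin n) → ℝ)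
    (j : Fin n ⊕ Fin n) (y w : EuclideanSpace ℝ (Fin n)) (hJ : DifferentiableAt ℝ J y)
    (hg : DifferentiableAt ℝ (g j) (J y)) :
    fderiv ℝ (Gfield g J j) y w
      = (deriv (g j) (J y) * fderiv ℝ J y w) • EuclideanSpace.single (Sum.elim id id j) (1 : ℝ) := by
  have h1 : HasFDerivAt (fun x => g j (J x)) (deriv (g j) (J y) • fderiv ℝ J y) y :=
    hg.hasDerivAt.comp_hasFDerivAt y hJ.hasFDerivAt
  have h2 := h1.smul_const (EuclideanSpace.single (Sum.elim id id j) (1 : ℝ) : EuclideanSpace ℝ (Fin n))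
  have h3 : HasFDerivAt (Gfield g J j) _ y := h2
  rw [h3.fderiv]
  simp

lemma bracket_sum {n : ℕ} (g : Fin n ⊕ Fin n → ℝ → ℝ) (J : EuclideanSpace ℝ (Fin n) → ℝ) (γ₂ : ℝ)
    (y : EuclideanSpace ℝ (Fin n)) (hJ : DifferentiableAt ℝ J y)
    (hg : ∀ j, DifferentiableAt ℝ (g j) (J y))
    (hgrel : ∀ j : Fin n, ∀ z : ℝ,
      g (Sum.inl j) z * deriv (g (Sum.inr j)) z -
        g (Sum.inr j) z * deriv (g (Sum.inl j)) z = -γ₂) :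
    ∑ p : Fin n, (fderiv ℝ (Gfield g J (Sum.inr p)) y (Gfield g J (Sum.inl p) y)
      - fderiv ℝ (Gfield g J (Sum.inl p)) y (Gfield g J (Sum.inr p) y))
      = -(γ₂ • gradient J y) := by
  have hgr : ∀ p, (gradient J y) p = fderiv ℝ J y (EuclideanSpace.single p (1 : ℝ)) := by
    intro p
    have h1 : inner ℝ (gradient J y) (EuclideanSpace.single p (1 : ℝ))
        = fderiv ℝ J y (EuclideanSpace.single p (1 : ℝ)) := by
      rw [gradient, InnerProductSpace.toDual_symm_apply]
    rw [← h1, EuclideanSpace.inner_single_right]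
    simp
  have h2 : ∀ p : Fin n, (fderiv ℝ (Gfield g J (Sum.inr p)) y (Gfield g J (Sum.inl p) y)
      - fderiv ℝ (Gfield g J (Sum.inl p)) y (Gfield g J (Sum.inr p) y))
      = (-(γ₂ * gradient J y p)) • EuclideanSpace.single p (1 : ℝ) := by
    intro p
    rw [Gfield_fderiv g J _ y _ hJ (hg _), Gfield_fderiv g J _ y _ hJ (hg _)]
    simp only [Gfield, Sum.elim_inl, Sum.elim_inr, id, map_smul, smul_eq_mul, ← sub_smul, hgr]
    congr 1
    linear_combination (fderiv ℝ J y (EuclideanSpace.single p (1 : ℝ))) * hgrel p (J y)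
  simp only [h2]
  ext i
  simp [Finset.sum_apply, Pi.single_apply]

lemma dither_eq {n : ℕ} (k : Fin n → ℕ) (μ : ℝ) (i : Fin n ⊕ Fin n) (t : ℝ) :
    dither k μ i t = uu k (fun _ => 1) (fun _ => 1) μ i t := by
  rcases i with p | p <;> simp [dither, uu]

lemma dither_bd {n : ℕ} (k : Fin n → ℕ) (μ : ℝ) (hμ : 0 < μ) (i : Fin n ⊕ Fin n) (t : ℝ) :
    |dither k μ i t| ≤ Real.sqrt (4 * π * ∑ p, (k p : ℝ)) / Real.sqrt μ := by
  rw [dither_eq]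
  have := uu_bound k (fun _ => 1) (fun _ => 1) μ hμ 1 (∑ p, (k p : ℝ)) zero_le_one (by simp)
    (by simp) (fun p => Finset.single_le_sum (f := fun p => (k p : ℝ))
      (fun _ _ => Nat.cast_nonneg _) (Finset.mem_univ p)) i t
  simpa using this

set_option maxHeartbeats 1000000 in
lemma xistep {n : ℕ} (D K K0 : Set (EuclideanSpace ℝ (Fin n))) (hD : IsOpen D)
    (xs : EuclideanSpace ℝ (Fin n)) (hK0 : IsCompact K0) (hK0D : K0 ⊆ D \ {xs})
    (J : EuclideanSpace ℝ (Fin n) → ℝ) (hJsmooth : ContDiffOn ℝ 2 J D)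
    (hgrad : ∀ x ∈ K0, fderiv ℝ J x ≠ 0)
    (γ₂ : ℝ) (g : Fin n ⊕ Fin n → ℝ → ℝ)
    (hgrel : ∀ j : Fin n, ∀ z : ℝ,
      g (Sum.inl j) z * deriv (g (Sum.inr j)) z -
        g (Sum.inr j) z * deriv (g (Sum.inl j)) z = -γ₂)
    (hg_smooth : ∀ j, ContDiffOn ℝ 2 (fun x => g j (J x)) (D \ {xs}))
    (Lg M : ℝ) (hLg0 : 0 ≤ Lg) (hM0 : 0 ≤ M)
    (hLg : ∀ x ∈ K, ∀ ξ ∈ K, ∀ i, |g i (J x) - g i (J ξ)| ≤ Lg * ‖x - ξ‖)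
    (hM : ∀ x ∈ K, ∀ i, |g i (J x)| ≤ M)
    (k : Fin n → ℕ) (hkpos : ∀ j, 0 < k j) (hkinj : Function.Injective k)
    (θ : ℝ) (hθ : 0 < θ) :
    ∃ μb > 0, ∀ μ ∈ Set.Ioc (0:ℝ) μb, ∃ η₀ > 0, ∀ (j : ℕ) (x ξ : ℝ → EuclideanSpace ℝ (Fin n)),
      ξ (μ * j) ∈ K0 → ContinuousOn ξ (Icc (μ * j) (μ * j + μ)) →
      (∀ t ∈ Ico (μ * j) (μ * j + μ), HasDerivWithinAt ξ
        (∑ j : Fin n ⊕ Fin n, dither k μ j t • Gfield g J j (x t)) (Ici t) t) →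
      (∀ t ∈ Icc (μ * j) (μ * j + μ), x t ∈ K ∧ ξ t ∈ K ∧ ‖x t - ξ t‖ ≤ η₀) →
      ‖ξ (μ * j + μ) - ξ (μ * j) + (μ * γ₂) • gradient J (ξ (μ * j))‖ ≤ μ * θ := by
  have hDo : IsOpen (D \ {xs}) := hD.sdiff isClosed_singleton
  have hGs : ∀ i, ContDiffOn ℝ 2 (Gfield g J i) (D \ {xs}) := fun i =>
    (hg_smooth i).smul contDiffOn_const
  obtain ⟨L, hL0, hL⟩ := fam_bd hK0 (h := fun i => fderiv ℝ (Gfield g J i))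
    (fun i => ((hGs i).continuousOn_fderiv_of_isOpen hDo (by norm_num)).mono hK0D)
  set Uc : ℝ := Real.sqrt (4 * π * ∑ p, (k p : ℝ)) with hUc
  have hUc0 : 0 ≤ Uc := Real.sqrt_nonneg _
  set N : ℝ := (Fintype.card (Fin n ⊕ Fin n) : ℝ) with hN
  have hN0 : 0 ≤ N := Nat.cast_nonneg _
  set C : ℝ := N * (Uc * M) with hC
  have hC0 : 0 ≤ C := by positivity
  obtain ⟨η₁, hη1, hη11, sb, hsb, htot⟩ := total_small N Uc C L 0 θ hN0 hUc0 hC0 hL0 le_rfl hθ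
  obtain ⟨d, hd, hmod⟩ := fam_mod hDo hK0 hK0D hGs hη1
  obtain ⟨r, hrp, hr1, hr2⟩ : ∃ r : ℝ, 0 < r ∧ r ≤ sb ∧ r ≤ d / (C + 1) := by
    refine ⟨min sb (d / (C + 1)), by positivity, ?_⟩
    simp
  refine ⟨r ^ 2, by positivity, fun μ hμ => ?_⟩
  have hμ0 : 0 < μ := hμ.1
  have hs0 : 0 < Real.sqrt μ := Real.sqrt_pos.2 hμ0
  have hsr : Real.sqrt μ ≤ r := by
    rw [← Real.sqrt_sq hrp.le]; exact Real.sqrt_le_sqrt hμ.2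
  have hss : Real.sqrt μ * Real.sqrt μ = μ := Real.mul_self_sqrt hμ0.le
  have hdb := dither_bd k μ hμ0
  set s := Real.sqrt μ with hs
  have hUs : 0 ≤ Uc / s := by positivity
  have hs_d : s * (C + 1) ≤ d := by
    have := hsr.trans hr2
    rwa [le_div_iff₀ (by positivity)] at this
  have hCs : C * s ≤ d := by linarith
  set Q : ℝ := N * (Uc / s * Lg) with hQ
  have hQ0 : 0 ≤ Q := by positivity
  obtain ⟨w, hwp, hw1, hw2⟩ : ∃ w : ℝ, 0 < w ∧ w ≤ 1 ∧ w ≤ θ / 4 :=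
    ⟨min 1 (θ / 4), by positivity, by simp⟩
  refine ⟨w / (Q + 1), by positivity, fun j x ξ hξ0 hξc hξd hK => ?_⟩
  set ξ₀ := ξ (μ * j) with hξ0d
  have hη0 : Q * (w / (Q + 1)) ≤ w := by
    rw [mul_div_assoc', div_le_iff₀ (by positivity)]
    linarith
  have hdisp : ∀ t ∈ Icc (μ * j) (μ * j + μ), ‖ξ t - ξ₀‖ ≤ C * s := by
    intro t ht
    have h1 := norm_image_sub_le_of_norm_deriv_right_le_segment (C := C / s) hξc hξd
      (fun t ht => by
        have h2 := norm_sum_smul_le (fun i => dither k μ i t) (fun i => Gfield g J i (x t)) hUs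
          (fun i => hdb i t) (W := M) (fun i => by
            rw [Gfield_norm]; exact hM _ (hK t ⟨ht.1, ht.2.le⟩).1 i)
        refine h2.trans (le_of_eq ?_)
        rw [hC]; ring) t ht
    refine h1.trans ?_
    calc C / s * (t - μ * j) ≤ C / s * μ := by
          gcongr; linarith [ht.2]
      _ = C * s := by rw [← hss]; field_simp
  set e : ℝ → EuclideanSpace ℝ (Fin n) := fun t =>
    ∑ i, dither k μ i t • (Gfield g J i (x t) - Gfield g J i (ξ t)) with he
  have heb : ∀ t ∈ Ico (μ * j) (μ * j + μ), ‖e t‖ ≤ w := by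
    intro t ht
    obtain ⟨k1, k2, k3⟩ := hK t ⟨ht.1, ht.2.le⟩
    have h2 := norm_sum_smul_le (fun i => dither k μ i t)
      (fun i => Gfield g J i (x t) - Gfield g J i (ξ t)) hUs
      (fun i => hdb i t) (W := Lg * (w / (Q + 1))) (fun i => by
        rw [Gfield_sub_norm]
        exact (hLg _ k1 _ k2 i).trans (mul_le_mul_of_nonneg_left k3 hLg0))
    refine h2.trans ?_
    refine le_trans (le_of_eq ?_) hη0
    rw [hQ]; ring
  have hder : ∀ t ∈ Ico (μ * j) (μ * j + μ), HasDerivWithinAt ξ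
      (0 + e t + ∑ i, uu k (fun _ => 1) (fun _ => 1) μ i t • Gfield g J i (ξ t)) (Ici t) t := by
    intro t ht
    convert hξd t ht using 1
    simp only [he, ← dither_eq, smul_sub, Finset.sum_sub_distrib]
    abel
  have key := avg k (fun _ => 1) (fun _ => 1) (Gfield g J) (fun i => fderiv ℝ (Gfield g J i) ξ₀)
    ξ e 0 μ (Uc / s) L η₁ (C * s) 0 w j hμ0 hUs hη1.le hkpos hkinj
    (fun i t => by rw [← dither_eq]; exact hdb i t) hξc hder heb (by simp) hdisp
    (fun i z hz => hmod i ξ₀ hξ0 z (hz.trans hCs)) (fun i => hL i ξ₀ hξ0) hL0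
  have hfin := htot μ hμ0 (hsr.trans hr1) w hwp.le hw1 hw2
  have hξD : ξ₀ ∈ D := (hK0D hξ0).1
  have hJc : ContDiffAt ℝ 2 J ξ₀ := hJsmooth.contDiffAt (hD.mem_nhds hξD)
  have hbr := bracket_sum g J γ₂ ξ₀ (hJc.differentiableAt (by norm_num))
    (fun i => diff_of_comp hJc (hgrad _ hξ0)
      (((hg_smooth i).contDiffAt (hDo.mem_nhds (hK0D hξ0))).differentiableAt (by norm_num))) hgrel
  simp only [mul_one, one_smul, zero_add] at key
  rw [← hξ0d, hbr] at key
  have e1 : ξ (μ * j + μ) - ξ₀ + (μ * γ₂) • gradient J ξ₀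
      = ξ (μ * j + μ) - ξ₀ - μ • (-(γ₂ • gradient J ξ₀)) := by
    rw [mul_smul, smul_neg, sub_neg_eq_add]
  rw [e1]
  refine key.trans ?_
  have := mul_le_mul_of_nonneg_left hfin hμ0.le
  rw [zero_add] at this
  exact this

end XiStep

section Core

lemma bootstrap {E : Type*} [NormedAddCommGroup E] {ξ : ℝ → E} {xs : E} {R : ℝ}
    (hc : ContinuousOn ξ (Ici 0)) (h0 : ‖ξ 0 - xs‖ ≤ R)
    (h : ∀ T, 0 ≤ T → (∀ s, 0 ≤ s → s ≤ T → ‖ξ s - xs‖ ≤ R) → ‖ξ T - xs‖ < R) :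
    ∀ t, 0 ≤ t → ‖ξ t - xs‖ ≤ R := by
  by_contra hcon
  push Not at hcon
  obtain ⟨t1, ht1, hlt⟩ := hcon
  set A : Set ℝ := Icc 0 t1 ∩ (fun t => ‖ξ t - xs‖) ⁻¹' (Ici R) with hA
  have hcn : ContinuousOn (fun t => ‖ξ t - xs‖) (Icc 0 t1) :=
    ((hc.mono Icc_subset_Ici_self).sub continuousOn_const).norm
  have hAc : IsCompact A := by
    refine isCompact_Icc.of_isClosed_subset ?_ inter_subset_left
    exact hcn.preimage_isClosed_of_isClosed isClosed_Icc isClosed_Ici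
  have hAn : A.Nonempty := ⟨t1, ⟨ht1, le_rfl⟩, hlt.le⟩
  obtain ⟨T, ⟨hT1, hT2⟩, hmin⟩ := hAc.exists_isLeast hAn
  have hlow : ∀ s, 0 ≤ s → s < T → ‖ξ s - xs‖ < R := by
    intro s hs hsT
    by_contra hge
    push Not at hge
    have := hmin (show s ∈ A from ⟨⟨hs, hsT.le.trans hT1.2⟩, hge⟩)
    linarith
  have hTR : ‖ξ T - xs‖ ≤ R := by
    rcases hT1.1.eq_or_lt with h00 | h00
    · rw [← h00]; exact h0
    · have hcw : ContinuousWithinAt (fun t => ‖ξ t - xs‖) (Ico 0 T) T :=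
        (hcn T hT1).mono (fun s hs => ⟨hs.1, hs.2.le.trans hT1.2⟩)
      haveI : (nhdsWithin T (Ico 0 T)).NeBot := by
        rw [← mem_closure_iff_nhdsWithin_neBot, closure_Ico h00.ne]
        exact ⟨h00.le, le_rfl⟩
      refine le_of_tendsto hcw ?_
      filter_upwards [self_mem_nhdsWithin] with s hs
      exact (hlow s hs.1 hs.2).le
  have := h T hT1.1 (fun s hs hsT => by
    rcases hsT.eq_or_lt with h1 | h1
    · rw [h1]; exact hTR
    · exact (hlow s hs h1).le)
  exact absurd hT2 (not_le.2 this)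

lemma floor_mul (ε s : ℝ) (hε : 0 < ε) (hs : 0 ≤ s) : ∃ j : ℕ, ε * j ≤ s ∧ s < ε * j + ε := by
  refine ⟨⌊s / ε⌋₊, ?_, ?_⟩
  · have := Nat.floor_le (div_nonneg hs hε.le)
    rw [le_div_iff₀ hε] at this; linarith
  · have := Nat.lt_floor_add_one (s / ε)
    rw [div_lt_iff₀ hε] at this; linarith

lemma xi_lip {E : Type*} [NormedAddCommGroup E] [NormedSpace ℝ E] {ξ ξ' : ℝ → E} {Cμ a b : ℝ}
    (hc : ContinuousOn ξ (Ici 0)) (hd : ∀ t, 0 ≤ t → HasDerivWithinAt ξ (ξ' t) (Ici t) t)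
    (ha : 0 ≤ a) (hab : a ≤ b) (hb : ∀ t ∈ Ico a b, ‖ξ' t‖ ≤ Cμ) :
    ‖ξ b - ξ a‖ ≤ Cμ * (b - a) :=
  norm_image_sub_le_of_norm_deriv_right_le_segment
    (hc.mono (fun t ht => ha.trans ht.1)) (fun t ht => hd t (ha.trans ht.1)) hb b ⟨hab, le_rfl⟩

lemma tracking {E : Type*} [NormedAddCommGroup E] [NormedSpace ℝ E] {x ξ ξ' : ℝ → E} {xs : E}
    {R2 R3 η ε θ γ₁ Cμ T : ℝ} (hη : 0 < η) (hR : R2 + η ≤ R3) (hε : 0 < ε)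
    (hθ1 : θ ≤ 1) (hθ2 : θ ≤ η / 4) (hCμ : 0 ≤ Cμ) (hεC : ε * Cμ ≤ η / 4) (hεγ : ε * γ₁ ≤ 1)
    (hγ : 1 + Cμ ≤ γ₁ * (η / 2)) (hx0 : x 0 = ξ 0)
    (hc : ContinuousOn ξ (Ici 0)) (hd : ∀ t, 0 ≤ t → HasDerivWithinAt ξ (ξ' t) (Ici t) t)
    (hξ' : ∀ t, 0 ≤ t → x t ∈ closedBall xs R3 → ‖ξ' t‖ ≤ Cμ)
    (hstep : ∀ j : ℕ, x (ε * j) ∈ closedBall xs R3 → ‖x (ε * j) - ξ (ε * j)‖ ≤ η →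
      (∀ t ∈ Icc (ε * j) (ε * j + ε), ‖x t - x (ε * j)‖ ≤ θ) ∧
      ‖x (ε * j + ε) - x (ε * j) + (ε * γ₁) • (x (ε * j) - ξ (ε * j))‖ ≤ ε * θ)
    (hT : ∀ s, 0 ≤ s → s ≤ T → ‖ξ s - xs‖ ≤ R2) :
    ∀ s, 0 ≤ s → s ≤ T → ‖x s - ξ s‖ ≤ η := by
  have hloc : ∀ j : ℕ, ε * j ≤ T → ‖x (ε * j) - ξ (ε * j)‖ ≤ η / 2 →
      (∀ t ∈ Icc (ε * j) (ε * j + ε), ‖x t - x (ε * j)‖ ≤ θ ∧ ‖ξ t - ξ (ε * j)‖ ≤ Cμ * (t - ε * j)) ∧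
      ‖x (ε * j + ε) - x (ε * j) + (ε * γ₁) • (x (ε * j) - ξ (ε * j))‖ ≤ ε * θ := by
    intro j hj hxj
    have hj0 : 0 ≤ ε * j := by positivity
    have hxs : ‖x (ε * j) - xs‖ ≤ R2 + η / 2 := by
      have := norm_sub_le_norm_sub_add_norm_sub (x (ε * j)) (ξ (ε * j)) xs
      linarith [hT _ hj0 hj]
    obtain ⟨h1, h2⟩ := hstep j (by rw [mem_closedBall, dist_eq_norm]; linarith) (by linarith)
    have hin : ∀ t ∈ Icc (ε * j) (ε * j + ε), x t ∈ closedBall xs R3 := by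
      intro t ht
      rw [mem_closedBall, dist_eq_norm]
      have := norm_sub_le_norm_sub_add_norm_sub (x t) (x (ε * j)) xs
      linarith [h1 t ht]
    refine ⟨fun t ht => ⟨h1 t ht, ?_⟩, h2⟩
    exact xi_lip hc hd hj0 ht.1 (fun s hs => hξ' s (hj0.trans hs.1)
      (hin s ⟨hs.1, hs.2.le.trans ht.2⟩))
  have hgrid : ∀ j : ℕ, ε * j ≤ T → ‖x (ε * j) - ξ (ε * j)‖ ≤ η / 2 := by
    intro j
    induction j with
    | zero => intro _; simp only [Nat.cast_zero, mul_zero, hx0, sub_self, norm_zero]; positivity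
    | succ j ih =>
      intro hj
      have e0 : ε * ((j + 1 : ℕ) : ℝ) = ε * j + ε := by push_cast; ring
      rw [e0] at hj ⊢
      have ih' := ih (by linarith)
      obtain ⟨h1, h2⟩ := hloc j (by linarith) ih'
      have h3 := (h1 (ε * j + ε) ⟨by linarith, le_rfl⟩).2
      rw [add_sub_cancel_left] at h3
      have e1 : x (ε * j + ε) - ξ (ε * j + ε)
          = (x (ε * j + ε) - x (ε * j) + (ε * γ₁) • (x (ε * j) - ξ (ε * j)))
            + (1 - ε * γ₁) • (x (ε * j) - ξ (ε * j)) - (ξ (ε * j + ε) - ξ (ε * j)) := by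
        rw [sub_smul, one_smul]; abel
      have h4 : ‖(1 - ε * γ₁) • (x (ε * j) - ξ (ε * j))‖ ≤ (1 - ε * γ₁) * (η / 2) := by
        rw [norm_smul, Real.norm_eq_abs, abs_of_nonneg (by linarith)]
        exact mul_le_mul_of_nonneg_left ih' (by linarith)
      rw [e1]
      have h5 := norm_sub_le ((x (ε * j + ε) - x (ε * j) + (ε * γ₁) • (x (ε * j) - ξ (ε * j)))
            + (1 - ε * γ₁) • (x (ε * j) - ξ (ε * j))) (ξ (ε * j + ε) - ξ (ε * j))
      have h6 := norm_add_le (x (ε * j + ε) - x (ε * j) + (ε * γ₁) • (x (ε * j) - ξ (ε * j)))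
            ((1 - ε * γ₁) • (x (ε * j) - ξ (ε * j)))
      have h7 := mul_le_mul_of_nonneg_left hγ hε.le
      have h8 := mul_le_mul_of_nonneg_left hθ1 hε.le
      linarith
  intro s hs hsT
  obtain ⟨j, hj1, hj2⟩ := floor_mul ε s hε hs
  have hg := hgrid j (hj1.trans hsT)
  obtain ⟨h1, -⟩ := hloc j (hj1.trans hsT) hg
  obtain ⟨h3, h4⟩ := h1 s ⟨hj1, hj2.le⟩
  have e1 : x s - ξ s = (x s - x (ε * j)) + (x (ε * j) - ξ (ε * j)) - (ξ s - ξ (ε * j)) := by abel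
  rw [e1]
  have h5 := norm_sub_le ((x s - x (ε * j)) + (x (ε * j) - ξ (ε * j))) (ξ s - ξ (ε * j))
  have h6 := norm_add_le (x s - x (ε * j)) (x (ε * j) - ξ (ε * j))
  have h7 : Cμ * (s - ε * j) ≤ Cμ * ε := mul_le_mul_of_nonneg_left (by linarith) hCμ
  linarith

lemma core {E : Type*} [NormedAddCommGroup E] [NormedSpace ℝ E] {x ξ ξ' : ℝ → E} {xs : E}
    {D : Set E} {V : E → ℝ}
    {σ11 σ12 δ ρ r c μ R1 R2 R3 η ε θ γ₁ Cμ : ℝ}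
    (hσ11 : 0 < σ11) (hσ12 : 0 < σ12) (hc0 : 0 < c) (hμ : 0 < μ) (hr0 : 0 < r)
    (hR10 : 0 ≤ R1) (hδ0 : 0 < δ)
    (hV : ∀ z ∈ D, σ11 * ‖z - xs‖ ^ 2 ≤ V z ∧ V z ≤ σ12 * ‖z - xs‖ ^ 2)
    (hR1 : σ12 * δ ^ 2 = σ11 * R1 ^ 2) (hrρ : σ12 * (2 * r) ^ 2 ≤ σ11 * (ρ / 2) ^ 2) (hρ : 0 < ρ)
    (hrδ : 2 * r ≤ δ) (hCμ1 : R1 + Cμ * μ < R2) (hCμ2 : Cμ * μ ≤ r) (hCμ3 : Cμ * μ + η ≤ ρ / 2)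
    (hη : 0 < η) (hR : R2 + η ≤ R3) (hε : 0 < ε)
    (hθ1 : θ ≤ 1) (hθ2 : θ ≤ η / 4) (hCμ : 0 ≤ Cμ) (hεC : ε * Cμ ≤ η / 4) (hεγ : ε * γ₁ ≤ 1)
    (hγ : 1 + Cμ ≤ γ₁ * (η / 2)) (hx0 : x 0 = ξ 0) (hx0δ : ‖ξ 0 - xs‖ ≤ δ)
    (hxD : ∀ t, 0 ≤ t → ξ t ∈ D)
    (hc : ContinuousOn ξ (Ici 0)) (hd : ∀ t, 0 ≤ t → HasDerivWithinAt ξ (ξ' t) (Ici t) t)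
    (hξ' : ∀ t, 0 ≤ t → x t ∈ closedBall xs R3 → ‖ξ' t‖ ≤ Cμ)
    (hstep : ∀ j : ℕ, x (ε * j) ∈ closedBall xs R3 → ‖x (ε * j) - ξ (ε * j)‖ ≤ η →
      (∀ t ∈ Icc (ε * j) (ε * j + ε), ‖x t - x (ε * j)‖ ≤ θ) ∧
      ‖x (ε * j + ε) - x (ε * j) + (ε * γ₁) • (x (ε * j) - ξ (ε * j))‖ ≤ ε * θ)
    (hstepξ : ∀ j : ℕ, r ≤ ‖ξ (μ * j) - xs‖ → ‖ξ (μ * j) - xs‖ ≤ R1 →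
      (∀ t ∈ Icc (μ * j) (μ * j + μ), x t ∈ closedBall xs R3 ∧ ξ t ∈ closedBall xs R3 ∧
        ‖x t - ξ t‖ ≤ η) → V (ξ (μ * j + μ)) ≤ V (ξ (μ * j)) - c * μ) :
    ∀ t, 0 ≤ t → ‖x t - xs‖ ≤
      (R3 / (2 * r) * Real.exp (σ12 * δ ^ 2 / c + μ)) * ‖ξ 0 - xs‖ * Real.exp (-1 * t) + ρ := by
  have hV0 : V (ξ 0) ≤ σ12 * δ ^ 2 := by
    refine ((hV _ (hxD 0 le_rfl)).2).trans ?_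
    gcongr
  have hsub : ∀ z ∈ D, V z ≤ σ12 * δ ^ 2 → ‖z - xs‖ ≤ R1 := by
    intro z hz hVz
    have h1 := (hV z hz).1.trans hVz
    rw [hR1] at h1
    exact le_of_sq_le_sq (le_of_mul_le_mul_left h1 hσ11) hR10
  set bb := σ12 * (2 * r) ^ 2 with hbb
  have hbδ : bb ≤ σ12 * δ ^ 2 := by rw [hbb]; gcongr
  -- analysis on a good interval
  have main : ∀ T, 0 ≤ T → (∀ s, 0 ≤ s → s ≤ T → ‖ξ s - xs‖ ≤ R2) →
      (∀ s, 0 ≤ s → s ≤ T → ‖x s - ξ s‖ ≤ η) ∧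
      (∀ j : ℕ, μ * j ≤ T → V (ξ (μ * j)) ≤ max (V (ξ 0) - c * μ * j) bb) ∧
      (∀ a b, 0 ≤ a → a ≤ b → b ≤ T → ‖ξ b - ξ a‖ ≤ Cμ * (b - a)) := by
    intro T hT0 hT
    have htr := tracking hη hR hε hθ1 hθ2 hCμ hεC hεγ hγ hx0 hc hd hξ' hstep hT
    have hxK : ∀ s, 0 ≤ s → s ≤ T → x s ∈ closedBall xs R3 := by
      intro s hs hsT
      rw [mem_closedBall, dist_eq_norm]
      have := norm_sub_le_norm_sub_add_norm_sub (x s) (ξ s) xs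
      linarith [hT s hs hsT, htr s hs hsT]
    have hlip : ∀ a b, 0 ≤ a → a ≤ b → b ≤ T → ‖ξ b - ξ a‖ ≤ Cμ * (b - a) := by
      intro a b ha hab hb
      exact xi_lip hc hd ha hab (fun t ht => hξ' t (ha.trans ht.1)
        (hxK t (ha.trans ht.1) (ht.2.le.trans hb)))
    refine ⟨htr, ?_, hlip⟩
    intro j
    induction j with
    | zero => intro _; simp
    | succ j ih =>
      intro hj
      have e0 : μ * ((j + 1 : ℕ) : ℝ) = μ * j + μ := by push_cast; ring
      rw [e0] at hj ⊢
      have hj0 : 0 ≤ μ * j := by positivity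
      have ih' := ih (by linarith)
      by_cases hcase : r ≤ ‖ξ (μ * j) - xs‖
      · have hVj : V (ξ (μ * j)) ≤ σ12 * δ ^ 2 := by
          refine ih'.trans (max_le ?_ hbδ)
          have : 0 ≤ c * μ * j := by positivity
          linarith
        have h1 := hstepξ j hcase (hsub _ (hxD _ hj0) hVj) (fun t ht => by
          have ht0 := hj0.trans ht.1
          have htT := ht.2.trans hj
          refine ⟨hxK t ht0 htT, ?_, htr t ht0 htT⟩
          rw [mem_closedBall, dist_eq_norm]
          linarith [hT t ht0 htT])
        have hcm : 0 < c * μ := by positivity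
        rcases le_max_iff.1 ih' with h2 | h2
        · refine le_max_of_le_left ?_
          push_cast
          linarith
        · refine le_max_of_le_right ?_
          linarith
      · push Not at hcase
        refine le_max_of_le_right ?_
        have h1 := hlip (μ * j) (μ * j + μ) hj0 (by linarith) hj
        rw [add_sub_cancel_left] at h1
        have h2 := norm_sub_le_norm_sub_add_norm_sub (ξ (μ * j + μ)) (ξ (μ * j)) xs
        refine ((hV _ (hxD _ (by linarith))).2).trans ?_
        have h3 : ‖ξ (μ * j + μ) - xs‖ ≤ 2 * r := by linarith
        rw [hbb]; gcongr
  have hR1δ : ‖ξ 0 - xs‖ ≤ R1 := hsub _ (hxD 0 le_rfl) hV0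
  have hboot : ∀ t, 0 ≤ t → ‖ξ t - xs‖ ≤ R2 := by
    refine bootstrap hc (by nlinarith) ?_
    intro T hT0 hT
    obtain ⟨-, h1, h2⟩ := main T hT0 hT
    obtain ⟨j, hj1, hj2⟩ := floor_mul μ T hμ hT0
    have hj0 : 0 ≤ μ * j := by positivity
    have h3 := h1 j hj1
    have hVj : V (ξ (μ * j)) ≤ σ12 * δ ^ 2 := by
      refine h3.trans (max_le ?_ hbδ)
      have : 0 ≤ c * μ * j := by positivity
      linarith
    have h4 := hsub _ (hxD _ hj0) hVj
    have h5 := h2 (μ * j) T hj0 hj1 le_rfl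
    have h6 : Cμ * (T - μ * j) ≤ Cμ * μ := mul_le_mul_of_nonneg_left (by linarith) hCμ
    have h7 := norm_sub_le_norm_sub_add_norm_sub (ξ T) (ξ (μ * j)) xs
    linarith
  intro t ht
  obtain ⟨h0, h1, h2⟩ := main t ht (fun s hs _ => hboot s hs)
  obtain ⟨j, hj1, hj2⟩ := floor_mul μ t hμ ht
  have hj0 : 0 ≤ μ * j := by positivity
  have hxt := h0 t ht le_rfl
  have hxx := norm_sub_le_norm_sub_add_norm_sub (x t) (ξ t) xs
  have hR30 : 0 ≤ R3 := by linarith [mul_nonneg hCμ hμ.le]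
  rcases le_max_iff.1 (h1 j hj1) with h3 | h3
  · -- transient phase
    by_cases hb : V (ξ 0) ≤ bb
    · have hVj : V (ξ (μ * j)) ≤ bb := by
        have : 0 ≤ c * μ * j := by positivity
        linarith
      have h4 : ‖ξ (μ * j) - xs‖ ≤ ρ / 2 := by
        have h5 := ((hV _ (hxD _ hj0)).1.trans hVj).trans hrρ
        exact le_of_sq_le_sq (le_of_mul_le_mul_left h5 hσ11) (by linarith)
      have h5 := h2 (μ * j) t hj0 hj1 le_rfl
      have h6 : Cμ * (t - μ * j) ≤ Cμ * μ := mul_le_mul_of_nonneg_left (by linarith) hCμ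
      have h7 := norm_sub_le_norm_sub_add_norm_sub (ξ t) (ξ (μ * j)) xs
      have h8 : 0 ≤ (R3 / (2 * r) * Real.exp (σ12 * δ ^ 2 / c + μ)) * ‖ξ 0 - xs‖ *
        Real.exp (-1 * t) := by positivity
      linarith
    · push Not at hb
      have h4 : 2 * r ≤ ‖ξ 0 - xs‖ := by
        have h5 := hb.le.trans (hV _ (hxD 0 le_rfl)).2
        exact le_of_sq_le_sq (le_of_mul_le_mul_left h5 hσ12) (norm_nonneg _)
      have hVn : 0 ≤ V (ξ (μ * j)) := le_trans (by positivity) (hV _ (hxD _ hj0)).1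
      have h5 : μ * j ≤ σ12 * δ ^ 2 / c := by
        rw [le_div_iff₀ hc0]; linarith
      have h6 : t ≤ σ12 * δ ^ 2 / c + μ := by linarith
      have h7 : 1 ≤ Real.exp (σ12 * δ ^ 2 / c + μ) * Real.exp (-1 * t) := by
        rw [← Real.exp_add]; apply Real.one_le_exp; linarith
      have h8 : R3 ≤ R3 / (2 * r) * ‖ξ 0 - xs‖ := by
        rw [div_mul_eq_mul_div, le_div_iff₀ (by positivity)]
        exact mul_le_mul_of_nonneg_left h4 hR30
      have h9 : ‖x t - xs‖ ≤ R3 := by linarith [hboot t ht]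
      have h10 : R3 * 1 ≤ (R3 / (2 * r) * ‖ξ 0 - xs‖) *
          (Real.exp (σ12 * δ ^ 2 / c + μ) * Real.exp (-1 * t)) :=
        mul_le_mul h8 h7 zero_le_one (by positivity)
      have e1 : (R3 / (2 * r) * Real.exp (σ12 * δ ^ 2 / c + μ)) * ‖ξ 0 - xs‖ * Real.exp (-1 * t)
        = (R3 / (2 * r) * ‖ξ 0 - xs‖) *
          (Real.exp (σ12 * δ ^ 2 / c + μ) * Real.exp (-1 * t)) := by ring
      rw [e1]; linarith
  · have h4 : ‖ξ (μ * j) - xs‖ ≤ ρ / 2 := by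
      have h5 := ((hV _ (hxD _ hj0)).1.trans h3).trans hrρ
      exact le_of_sq_le_sq (le_of_mul_le_mul_left h5 hσ11) (by linarith)
    have h5 := h2 (μ * j) t hj0 hj1 le_rfl
    have h6 : Cμ * (t - μ * j) ≤ Cμ * μ := mul_le_mul_of_nonneg_left (by linarith) hCμ
    have h7 := norm_sub_le_norm_sub_add_norm_sub (ξ t) (ξ (μ * j)) xs
    have h8 : 0 ≤ (R3 / (2 * r) * Real.exp (σ12 * δ ^ 2 / c + μ)) * ‖ξ 0 - xs‖ *
      Real.exp (-1 * t) := by positivity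
    linarith

lemma Jdec {n : ℕ} (D K0 : Set (EuclideanSpace ℝ (Fin n))) (hD : IsOpen D)
    (hK0 : IsCompact K0) (hK0D : K0 ⊆ D) (J : EuclideanSpace ℝ (Fin n) → ℝ)
    (hJsmooth : ContDiffOn ℝ 2 J D) (m0 γ₂ : ℝ) (hm0 : 0 < m0) (hγ₂ : 0 < γ₂)
    (hgrad : ∀ x ∈ K0, m0 ≤ ‖gradient J x‖ ^ 2) :
    ∃ θ > 0, ∃ c > 0, ∃ μ1 > 0, ∀ μ ∈ Ioc (0 : ℝ) μ1, ∀ z ∈ K0, ∀ z',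
      ‖z' - z + (μ * γ₂) • gradient J z‖ ≤ μ * θ → J z' ≤ J z - c * μ := by
  obtain ⟨Gm, hGm0, hGm⟩ := fam_bd hK0 (ι := Unit) (h := fun _ => fderiv ℝ J)
    (fun _ => (hJsmooth.continuousOn_fderiv_of_isOpen hD (by norm_num)).mono hK0D)
  have hgn : ∀ z, ‖gradient J z‖ = ‖fderiv ℝ J z‖ := fun z => by
    rw [gradient, LinearIsometryEquiv.norm_map]
  have hq : 0 < γ₂ * Gm + 1 := by positivity
  obtain ⟨d, hd, hmod⟩ := unif_diff hD hK0 hK0D hJsmooth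
    (η := γ₂ * m0 / (4 * (γ₂ * Gm + 1))) (by positivity)
  refine ⟨min 1 (γ₂ * m0 / (4 * (Gm + 1))), by positivity, γ₂ * m0 / 2, by positivity,
    d / (γ₂ * Gm + 1), by positivity, fun μ hμ z hz z' hzz => ?_⟩
  set θ := min 1 (γ₂ * m0 / (4 * (Gm + 1))) with hθ
  have hθ1 : θ ≤ 1 := min_le_left _ _
  have hθ2 : θ * (4 * (Gm + 1)) ≤ γ₂ * m0 := by
    rw [← le_div_iff₀ (by positivity)]; exact min_le_right _ _
  have hθ0 : 0 < θ := by positivity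
  have hμ0 := hμ.1
  have hμd : μ * (γ₂ * Gm + 1) ≤ d := by
    rw [← le_div_iff₀ (by positivity)]; exact hμ.2
  have hG : ‖gradient J z‖ ≤ Gm := by rw [hgn]; exact hGm () z hz
  set w := z' - z + (μ * γ₂) • gradient J z with hw
  have hΔ : z' - z = w - (μ * γ₂) • gradient J z := by rw [hw]; abel
  have hμθ : μ * θ ≤ μ * 1 := mul_le_mul_of_nonneg_left hθ1 hμ0.le
  have hΔn : ‖z' - z‖ ≤ μ * (γ₂ * Gm + 1) := by
    rw [hΔ]
    refine (norm_sub_le _ _).trans ?_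
    rw [norm_smul, Real.norm_eq_abs, abs_of_pos (by positivity)]
    have := mul_le_mul_of_nonneg_left hG (mul_pos hμ0 hγ₂).le
    linarith
  have h1 := hmod z hz z' (hΔn.trans hμd)
  have h2 : fderiv ℝ J z (z' - z) = inner ℝ (gradient J z) (z' - z) := by
    rw [gradient, InnerProductSpace.toDual_symm_apply]
  have h3 : inner ℝ (gradient J z) (z' - z)
      = inner ℝ (gradient J z) w - (μ * γ₂) * ‖gradient J z‖ ^ 2 := by
    rw [hΔ, inner_sub_right, inner_smul_right, real_inner_self_eq_norm_sq]
  have h4 : inner ℝ (gradient J z) w ≤ Gm * (μ * θ) :=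
    (real_inner_le_norm _ _).trans (mul_le_mul hG hzz (norm_nonneg _) hGm0)
  have h5 : (γ₂ * m0 / (4 * (γ₂ * Gm + 1))) * ‖z' - z‖ ≤ γ₂ * m0 / 4 * μ := by
    calc _ ≤ (γ₂ * m0 / (4 * (γ₂ * Gm + 1))) * (μ * (γ₂ * Gm + 1)) := by gcongr
      _ = _ := by field_simp
  have h6 := (le_abs_self _).trans h1
  have h7 := mul_le_mul_of_nonneg_left (hgrad z hz) (mul_pos hμ0 hγ₂).le
  have h8 := mul_le_mul_of_nonneg_left hθ2 hμ0.le
  rw [h2, h3] at h6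
  have h9 : 0 ≤ μ * θ := by positivity
  linarith

lemma ball_infDist_sub {E : Type*} [NormedAddCommGroup E] [NormedSpace ℝ E] {D : Set E} {xs : E}
    (hD : IsOpen D) (hxs : xs ∈ D) : ball xs (infDist xs (frontier D)) ⊆ D := by
  by_contra hcon
  rw [not_subset] at hcon
  obtain ⟨y, hy, hyD⟩ := hcon
  have hpos : 0 < infDist xs (frontier D) := pos_of_mem_ball hy
  have hpre : IsPreconnected (ball xs (infDist xs (frontier D))) :=
    (convex_ball _ _).isPreconnected
  have hdis : ∀ z ∈ ball xs (infDist xs (frontier D)), z ∉ frontier D := by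
    intro z hz1 hz2
    have h1 := infDist_le_dist_of_mem (x := xs) hz2
    rw [mem_ball, dist_comm] at hz1
    linarith
  have hcov : ∀ z ∈ ball xs (infDist xs (frontier D)), z ∉ D → z ∈ (closure D)ᶜ := by
    intro z hz hzD hzc
    refine hdis z hz ?_
    rw [frontier, hD.interior_eq]
    exact ⟨hzc, hzD⟩
  obtain ⟨z, _, hz1, hz2⟩ := hpre D (closure D)ᶜ hD isClosed_closure.isOpen_compl
    (fun z hz => by
      by_cases h : z ∈ D
      · exact Or.inl h
      · exact Or.inr (hcov z hz h)) ⟨xs, mem_ball_self hpos, hxs⟩ ⟨y, hy, hcov y hy hyD⟩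
  exact hz2 (subset_closure hz1)

end Core
/-- **Theorem 1 (semi-global practical exponential extremum seeking for nonholonomic
systems).** Under the bracket-generating, boundedness, cost-function, and generating-function
assumptions, for every `δ ∈ (0, √(σ₁₁/σ₁₂)·dist(x*,∂D))` and every `ρ > 0` there exist
`μ̄ > 0`, thresholds `γ̄₁(μ) > 0` and `ε̄(γ₁,μ) > 0` such that for all `μ ∈ (0,μ̄]`,
`γ₁ ≥ γ̄₁(μ)`, `ε ∈ (0,ε̄(γ₁,μ)]` there are `β, λ > 0` such that every `π_ε`-solution of the
closed loop with `x(0) = ξ(0) = x⁰ ∈ B̄_δ(x*)` satisfies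
`‖x(t) − x*‖ ≤ β‖x⁰ − x*‖e^{−λt} + ρ` for all `t ≥ 0`. -/
theorem extremum_seeking_nonholonomic
    (n m : ℕ) (hn : 0 < n) (hmn : m < n)
    (D : Set (EuclideanSpace ℝ (Fin n))) (hD : IsOpen D)
    (f : Fin m → EuclideanSpace ℝ (Fin n) → EuclideanSpace ℝ (Fin n))
    (hf_smooth : ∀ i, ContDiffOn ℝ 2 (f i) D)
    (hf_indep : ∀ x ∈ D, LinearIndependent ℝ fun i : Fin m => f i x)
    (S₁ : Finset (Fin m)) (S₂ : Finset (Fin m × Fin m))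
    (hcard : S₁.card + S₂.card = n)
    (idx : (↥S₁ ⊕ ↥S₂) ≃ Fin n)
    (hrank : ∀ x ∈ D, Submodule.span ℝ (Set.range fun j => col f S₁ S₂ idx x j) = ⊤)
    (α : ℝ) (hα : 0 < α)
    (hFinv : ∀ x ∈ D, ∀ v : EuclideanSpace ℝ (Fin n),
      ‖((WithLp.equiv 2 (Fin n → ℝ)).symm ((Fmat f S₁ S₂ idx x)⁻¹ *ᵥ (fun i => v i)))‖ ≤ α * ‖v‖)
    (J : EuclideanSpace ℝ (Fin n) → ℝ) (hJsmooth : ContDiffOn ℝ 2 J D)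
    (xs : EuclideanSpace ℝ (Fin n)) (hxs : xs ∈ D)
    (σ11 σ12 σ21 σ22 σ3 : ℝ)
    (hσ11 : 0 < σ11) (hσ12 : 0 < σ12) (hσ21 : 0 < σ21) (hσ22 : 0 < σ22) (hσ3 : 0 < σ3)
    (hJ1 : ∀ x ∈ D, σ11 * ‖x - xs‖ ^ 2 ≤ J x - J xs ∧ J x - J xs ≤ σ12 * ‖x - xs‖ ^ 2)
    (hJ2 : ∀ x ∈ D, σ21 * (J x - J xs) ≤ ‖gradient J x‖ ^ 2 ∧
      ‖gradient J x‖ ^ 2 ≤ σ22 * (J x - J xs))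
    (hJ3 : ∀ x ∈ D, ‖fderiv ℝ (fun y => fderiv ℝ J y) x‖ ≤ σ3)
    (γ₂ : ℝ) (hγ₂ : 0 < γ₂)
    (g : Fin n ⊕ Fin n → ℝ → ℝ)
    (hgrel : ∀ j : Fin n, ∀ z : ℝ,
      g (Sum.inl j) z * deriv (g (Sum.inr j)) z -
        g (Sum.inr j) z * deriv (g (Sum.inl j)) z = -γ₂)
    (hg_smooth : ∀ j, ContDiffOn ℝ 2 (fun x => g j (J x)) (D \ {xs}))
    (hg_cont1 : ∀ i j, ContinuousOn
      (fun x => fderiv ℝ (Gfield g J i) x (Gfield g J j x)) D)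
    (hg_cont2 : ∀ i j l, ContinuousOn
      (fun x => fderiv ℝ (fun y => fderiv ℝ (Gfield g J i) y (Gfield g J j y)) x
        (Gfield g J l x)) D)
    (hg_lip : ∀ D' ⊆ D, IsCompact D' → ∃ Lg L2g M3g : ℝ, 0 ≤ Lg ∧ 0 ≤ L2g ∧ 0 ≤ M3g ∧
      ∀ x ∈ D', ∀ ξ ∈ D',
        (∀ i, |g i (J x) - g i (J ξ)| ≤ Lg * ‖x - ξ‖) ∧
        (∀ i j, ‖fderiv ℝ (Gfield g J i) ξ (Gfield g J j x - Gfield g J j ξ)‖ ≤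
          L2g * ‖x - ξ‖) ∧
        (∀ i j l, ‖fderiv ℝ (fun y => fderiv ℝ (Gfield g J i) y (Gfield g J j y)) ξ
          (Gfield g J l x)‖ ≤ M3g))
    (κ : Fin m × Fin m → ℕ) (hκpos : ∀ p ∈ S₂, 0 < κ p)
    (hκinj : Set.InjOn κ S₂)
    (k : Fin n → ℕ) (hkpos : ∀ j, 0 < k j) (hkinj : Function.Injective k)
    (δ ρ : ℝ) (hδ0 : 0 < δ)
    (hδ : δ < Real.sqrt (σ11 / σ12) * Metric.infDist xs (frontier D))
    (hρ : 0 < ρ) :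
    ∃ μbar > 0, ∃ γbar : ℝ → ℝ, ∃ εbar : ℝ → ℝ → ℝ,
      (∀ μ ∈ Set.Ioc (0:ℝ) μbar, 0 < γbar μ) ∧
      (∀ μ ∈ Set.Ioc (0:ℝ) μbar, ∀ γ₁, γbar μ ≤ γ₁ → 0 < εbar γ₁ μ) ∧
      (∀ μ ∈ Set.Ioc (0:ℝ) μbar, ∀ γ₁, γbar μ ≤ γ₁ →
        ∀ ε ∈ Set.Ioc (0:ℝ) (εbar γ₁ μ),
        ∃ β > 0, ∃ lam > 0,
          ∀ (x ξ : ℝ → EuclideanSpace ℝ (Fin n)) (x0 : EuclideanSpace ℝ (Fin n)),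
            x0 ∈ Metric.closedBall xs δ →
            x 0 = x0 → ξ 0 = x0 →
            (∀ t : ℝ, 0 ≤ t → x t ∈ D ∧ ξ t ∈ D) →
            ContinuousOn x (Set.Ici 0) → ContinuousOn ξ (Set.Ici 0) →
            (∀ j : ℕ, ∀ t ∈ Set.Ico (ε * j) (ε * (j + 1)),
              HasDerivWithinAt x
                (∑ i : Fin m,
                  ctrl f S₁ S₂ idx κ γ₁ ε (x (ε * j)) (ξ (ε * j)) i t • f i (x t))
                (Set.Ici t) t) →
            (∀ t : ℝ, 0 ≤ t →
              HasDerivWithinAt ξ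
                (∑ j : Fin n ⊕ Fin n, dither k μ j t • Gfield g J j (x t))
                (Set.Ici t) t) →
            ∀ t : ℝ, 0 ≤ t →
              ‖x t - xs‖ ≤ β * ‖x0 - xs‖ * Real.exp (-lam * t) + ρ) := by
  suffices H : ∃ μbar > 0, ∀ μ ∈ Set.Ioc (0:ℝ) μbar, ∃ γb > 0, ∀ γ₁, γb ≤ γ₁ → ∃ εb > 0,
        ∀ ε ∈ Set.Ioc (0:ℝ) εb, ∃ β > 0, ∃ lam > 0,
          ∀ (x ξ : ℝ → EuclideanSpace ℝ (Fin n)) (x0 : EuclideanSpace ℝ (Fin n)),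
            x0 ∈ Metric.closedBall xs δ →
            x 0 = x0 → ξ 0 = x0 →
            (∀ t : ℝ, 0 ≤ t → x t ∈ D ∧ ξ t ∈ D) →
            ContinuousOn x (Set.Ici 0) → ContinuousOn ξ (Set.Ici 0) →
            (∀ j : ℕ, ∀ t ∈ Set.Ico (ε * j) (ε * (j + 1)),
              HasDerivWithinAt x
                (∑ i : Fin m,
                  ctrl f S₁ S₂ idx κ γ₁ ε (x (ε * j)) (ξ (ε * j)) i t • f i (x t))
                (Set.Ici t) t) →
            (∀ t : ℝ, 0 ≤ t →
              HasDerivWithinAt ξ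
                (∑ j : Fin n ⊕ Fin n, dither k μ j t • Gfield g J j (x t))
                (Set.Ici t) t) →
            ∀ t : ℝ, 0 ≤ t →
              ‖x t - xs‖ ≤ β * ‖x0 - xs‖ * Real.exp (-lam * t) + ρ by
    obtain ⟨μbar, hμbar, H⟩ := H
    choose! γb hγb H using H
    choose! εb hεb H using H
    exact ⟨μbar, hμbar, γb, fun γ₁ μ => εb μ γ₁, hγb, hεb, H⟩
  obtain ⟨q, hq⟩ : ∃ q, q = Real.sqrt (σ11 / σ12) := ⟨_, rfl⟩
  rw [← hq] at hδ
  have hq0 : 0 < q := by rw [hq]; positivity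
  have hq2 : σ12 * q ^ 2 = σ11 := by
    rw [hq, Real.sq_sqrt (by positivity)]; field_simp
  obtain ⟨d0, hd0⟩ : ∃ d, d = Metric.infDist xs (frontier D) := ⟨_, rfl⟩
  rw [← hd0] at hδ
  obtain ⟨R1, hR1⟩ : ∃ R, R = δ / q := ⟨_, rfl⟩
  have hR1p : 0 < R1 := by rw [hR1]; positivity
  have hR1q : R1 * q = δ := by rw [hR1]; field_simp
  have hR1d : R1 < d0 := by rw [hR1, div_lt_iff₀ hq0]; linarith
  have hR1e : σ12 * δ ^ 2 = σ11 * R1 ^ 2 := by rw [← hR1q, ← hq2]; ring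
  obtain ⟨R2, hR2⟩ : ∃ R, R = R1 + (d0 - R1) / 3 := ⟨_, rfl⟩
  obtain ⟨R3, hR3⟩ : ∃ R, R = R1 + 2 * (d0 - R1) / 3 := ⟨_, rfl⟩
  have hR12 : R1 < R2 := by linarith
  have hR23 : R2 < R3 := by linarith
  have hR3p : 0 < R3 := by linarith
  have hR3d : R3 < d0 := by linarith
  have hKD : closedBall xs R3 ⊆ D := by
    refine (closedBall_subset_ball hR3d).trans ?_
    rw [hd0]
    exact ball_infDist_sub hD hxs
  have hK : IsCompact (closedBall xs R3) := isCompact_closedBall _ _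
  obtain ⟨r, hr0, hr1, hr2⟩ : ∃ r : ℝ, 0 < r ∧ r ≤ ρ / 4 * q ∧ r ≤ δ / 2 :=
    ⟨min (ρ / 4 * q) (δ / 2), by positivity, min_le_left _ _, min_le_right _ _⟩
  have hrρ : σ12 * (2 * r) ^ 2 ≤ σ11 * (ρ / 2) ^ 2 := by
    rw [← hq2]
    have h1 : (2 * r) ^ 2 ≤ (q * (ρ / 2)) ^ 2 := by
      apply pow_le_pow_left₀ (by positivity); linarith
    calc σ12 * (2 * r) ^ 2 ≤ σ12 * (q * (ρ / 2)) ^ 2 := by gcongr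
      _ = _ := by ring
  obtain ⟨K0, hK0def⟩ : ∃ K0, K0 = closedBall xs R1 \ ball xs r := ⟨_, rfl⟩
  have hK0 : IsCompact K0 := by
    rw [hK0def]; exact (isCompact_closedBall _ _).diff isOpen_ball
  have hK0K : K0 ⊆ closedBall xs R3 := by
    rw [hK0def]
    exact sdiff_subset.trans (closedBall_subset_closedBall (by linarith))
  have hK0D : K0 ⊆ D := hK0K.trans hKD
  have hK0r : ∀ z ∈ K0, r ≤ ‖z - xs‖ := by
    intro z hz
    rw [hK0def] at hz
    have := hz.2
    rw [mem_ball, dist_eq_norm] at this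
    exact not_lt.mp this
  have hK0D' : K0 ⊆ D \ {xs} := by
    intro z hz
    refine ⟨hK0D hz, fun h => ?_⟩
    have h1 := hK0r z hz
    rw [mem_singleton_iff.mp h, sub_self, norm_zero] at h1
    linarith
  have hgrad : ∀ z ∈ K0, σ21 * (σ11 * r ^ 2) ≤ ‖gradient J z‖ ^ 2 := by
    intro z hz
    refine le_trans ?_ (hJ2 z (hK0D hz)).1
    have h1 := (hJ1 z (hK0D hz)).1
    have h2 : r ^ 2 ≤ ‖z - xs‖ ^ 2 := pow_le_pow_left₀ hr0.le (hK0r z hz) 2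
    have h3 : σ11 * r ^ 2 ≤ σ11 * ‖z - xs‖ ^ 2 := by gcongr
    exact mul_le_mul_of_nonneg_left (h3.trans h1) hσ21.le
  have hgrad' : ∀ z ∈ K0, fderiv ℝ J z ≠ 0 := by
    intro z hz h0
    have h1 := hgrad z hz
    rw [gradient, h0, map_zero, norm_zero] at h1
    have : 0 < σ21 * (σ11 * r ^ 2) := by positivity
    linarith
  obtain ⟨θJ, hθJ, c, hc, μ1, hμ1, hJd⟩ := Jdec D K0 hD hK0 hK0D J hJsmooth
    (σ21 * (σ11 * r ^ 2)) γ₂ (by positivity) hγ₂ hgrad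
  obtain ⟨Lg, _, _, hLg0, _, _, hLgall⟩ := hg_lip (closedBall xs R3) hKD hK
  have hLg : ∀ x ∈ closedBall xs R3, ∀ ξ ∈ closedBall xs R3, ∀ i,
      |g i (J x) - g i (J ξ)| ≤ Lg * ‖x - ξ‖ := fun x hx ξ hξ => (hLgall x hx ξ hξ).1
  obtain ⟨M, hMdef⟩ : ∃ M, M = (∑ i, |g i (J xs)|) + Lg * R3 := ⟨_, rfl⟩
  have hM0 : 0 ≤ M := by
    rw [hMdef]
    have : 0 ≤ ∑ i, |g i (J xs)| := Finset.sum_nonneg fun _ _ => abs_nonneg _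
    positivity
  have hM : ∀ x ∈ closedBall xs R3, ∀ i, |g i (J x)| ≤ M := by
    intro x hx i
    have h1 := hLg x hx xs (mem_closedBall_self hR3p.le) i
    rw [mem_closedBall, dist_eq_norm] at hx
    have h2 : Lg * ‖x - xs‖ ≤ Lg * R3 := mul_le_mul_of_nonneg_left hx hLg0
    have h3 : |g i (J xs)| ≤ ∑ i, |g i (J xs)| :=
      Finset.single_le_sum (f := fun i => |g i (J xs)|) (fun _ _ => abs_nonneg _) (Finset.mem_univ i)
    have h4 := abs_sub_abs_le_abs_sub (g i (J x)) (g i (J xs))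
    rw [hMdef]; linarith
  obtain ⟨μb, hμb, hxi⟩ := xistep D (closedBall xs R3) K0 hD xs hK0 hK0D' J hJsmooth hgrad' γ₂ g
    hgrel hg_smooth Lg M hLg0 hM0 hLg hM k hkpos hkinj θJ hθJ
  obtain ⟨Uc, hUc⟩ : ∃ U, U = Real.sqrt (4 * π * ∑ p, (k p : ℝ)) := ⟨_, rfl⟩
  have hUc0 : 0 ≤ Uc := by rw [hUc]; positivity
  obtain ⟨N, hN⟩ : ∃ N : ℝ, N = (Fintype.card (Fin n ⊕ Fin n) : ℝ) := ⟨_, rfl⟩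
  have hN0 : 0 ≤ N := by rw [hN]; positivity
  obtain ⟨Cξ, hCξ⟩ : ∃ C, C = N * (Uc * M) := ⟨_, rfl⟩
  have hCξ0 : 0 ≤ Cξ := by rw [hCξ]; positivity
  obtain ⟨w, hw0, hw1, hw2, hw3⟩ : ∃ w : ℝ, 0 < w ∧ w ≤ (R2 - R1) / 2 ∧ w ≤ r ∧ w ≤ ρ / 4 := by
    refine ⟨min ((R2 - R1) / 2) (min r (ρ / 4)), ?_, min_le_left _ _,
      (min_le_right _ _).trans (min_le_left _ _), (min_le_right _ _).trans (min_le_right _ _)⟩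
    exact lt_min (by linarith) (lt_min hr0 (by linarith))
  obtain ⟨μbar, hμbar, hm1, hm2, hm3⟩ : ∃ m : ℝ, 0 < m ∧ m ≤ μb ∧ m ≤ μ1 ∧
      m ≤ (w / (Cξ + 1)) ^ 2 :=
    ⟨min μb (min μ1 ((w / (Cξ + 1)) ^ 2)), by positivity, min_le_left _ _,
      (min_le_right _ _).trans (min_le_left _ _), (min_le_right _ _).trans (min_le_right _ _)⟩
  refine ⟨μbar, hμbar, fun μ hμ => ?_⟩
  have hμ0 : 0 < μ := hμ.1
  obtain ⟨η₀, hη₀, hxi⟩ := hxi μ ⟨hμ0, hμ.2.trans hm1⟩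
  have hJd := hJd μ ⟨hμ0, hμ.2.trans hm2⟩
  obtain ⟨s, hs⟩ : ∃ s, s = Real.sqrt μ := ⟨_, rfl⟩
  have hs0 : 0 < s := by rw [hs]; positivity
  have hs2 : s * s = μ := by rw [hs]; exact Real.mul_self_sqrt hμ0.le
  have hsw : Cξ * s ≤ w := by
    have h1 : s ≤ w / (Cξ + 1) := by
      rw [hs]; exact Real.sqrt_le_iff.mpr ⟨by positivity, hμ.2.trans hm3⟩
    rw [le_div_iff₀ (by positivity)] at h1
    linarith
  obtain ⟨Cμ, hCμdef⟩ : ∃ C, C = N * (Uc / s * M) := ⟨_, rfl⟩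
  have hCμ0 : 0 ≤ Cμ := by rw [hCμdef]; positivity
  have hCμw : Cμ * μ ≤ w := by
    have : Cμ * μ = Cξ * s := by rw [hCμdef, hCξ, ← hs2]; field_simp
    rw [this]; exact hsw
  obtain ⟨η, hη0, hη1, hη2, hη3⟩ : ∃ η : ℝ, 0 < η ∧ η ≤ η₀ ∧ η ≤ R3 - R2 ∧ η ≤ ρ / 4 := by
    refine ⟨min η₀ (min (R3 - R2) (ρ / 4)), ?_, min_le_left _ _,
      (min_le_right _ _).trans (min_le_left _ _), (min_le_right _ _).trans (min_le_right _ _)⟩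
    exact lt_min hη₀ (lt_min (by linarith) (by linarith))
  refine ⟨2 * (1 + Cμ) / η, by positivity, fun γ₁ hγ => ?_⟩
  have hγ0 : 0 < γ₁ := lt_of_lt_of_le (by positivity) hγ
  have hγη : 1 + Cμ ≤ γ₁ * (η / 2) := by
    rw [div_le_iff₀ hη0] at hγ; linarith
  obtain ⟨θ, hθ0, hθ1, hθ2⟩ : ∃ θ : ℝ, 0 < θ ∧ θ ≤ 1 ∧ θ ≤ η / 4 :=
    ⟨min 1 (η / 4), by positivity, min_le_left _ _, min_le_right _ _⟩
  obtain ⟨εb, hεb, hxst⟩ := xstep f S₁ S₂ idx D (closedBall xs R3) hD hK hKD hf_smooth hrank α hα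
    hFinv κ hκpos hκinj γ₁ η θ hγ0 hη0 hθ0
  obtain ⟨εc, hεc, he1, he2, he3⟩ : ∃ e : ℝ, 0 < e ∧ e ≤ εb ∧ e ≤ η / 4 / (Cμ + 1) ∧ e ≤ 1 / γ₁ :=
    ⟨min εb (min (η / 4 / (Cμ + 1)) (1 / γ₁)), by positivity, min_le_left _ _,
      (min_le_right _ _).trans (min_le_left _ _), (min_le_right _ _).trans (min_le_right _ _)⟩
  refine ⟨εc, hεc, fun ε hε => ?_⟩
  have hε0 : 0 < ε := hε.1
  have hxst := hxst ε ⟨hε0, hε.2.trans he1⟩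
  have hεC : ε * Cμ ≤ η / 4 := by
    have h1 := hε.2.trans he2
    rw [le_div_iff₀ (by positivity)] at h1
    linarith
  have hεγ : ε * γ₁ ≤ 1 := by
    have h1 := hε.2.trans he3
    rwa [le_div_iff₀ hγ0] at h1
  refine ⟨R3 / (2 * r) * Real.exp (σ12 * δ ^ 2 / c + μ), by positivity, 1, one_pos, ?_⟩
  intro x ξ x0 hx0 hx0e hξ0e hin hxc hξc hxd hξd
  rw [← hξ0e] at hx0 hx0e ⊢
  rw [mem_closedBall, dist_eq_norm] at hx0
  refine core (D := D) (V := fun z => J z - J xs) (R1 := R1) (R2 := R2) (R3 := R3) (η := η)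
    (ε := ε) (θ := θ) (γ₁ := γ₁) (Cμ := Cμ) (r := r) (c := c) (μ := μ)
    (ξ' := fun t => ∑ j : Fin n ⊕ Fin n, dither k μ j t • Gfield g J j (x t))
    hσ11 hσ12 hc hμ0 hr0 hR1p.le hδ0 hJ1 hR1e hrρ hρ (by linarith) (by linarith)
    (by linarith) (by linarith) hη0 (by linarith) hε0 hθ1 hθ2 hCμ0 hεC hεγ hγη hx0e hx0
    (fun t ht => (hin t ht).2) hξc hξd ?_ ?_ ?_
  · intro t ht hxt
    rw [hCμdef, hN]
    refine norm_sum_smul_le _ _ (by positivity) (fun i => ?_) (fun i => ?_)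
    · rw [hUc, hs]; exact dither_bd k μ hμ0 i t
    · rw [Gfield_norm]; exact hM _ hxt i
  · intro j hj1 hj2
    have hj0 : 0 ≤ ε * (j : ℝ) := by positivity
    refine hxst j x (ξ (ε * j)) hj1 hj2
      (hxc.mono fun t ht => hj0.trans ht.1) (fun t ht => hxd j t ⟨ht.1, ?_⟩)
    have := ht.2
    linarith
  · intro j hj1 hj2 hj3
    have hj0 : 0 ≤ μ * (j : ℝ) := by positivity
    have hmem : ξ (μ * j) ∈ K0 := by
      rw [hK0def]
      refine ⟨by rwa [mem_closedBall, dist_eq_norm], ?_⟩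
      rw [mem_ball, dist_eq_norm]
      exact not_lt.mpr hj1
    have h1 := hxi j x ξ hmem (hξc.mono fun t ht => hj0.trans ht.1)
      (fun t ht => hξd t (hj0.trans ht.1))
      (fun t ht => ⟨(hj3 t ht).1, (hj3 t ht).2.1, (hj3 t ht).2.2.trans hη1⟩)
    have h2 := hJd _ hmem _ h1
    show J _ - J xs ≤ J _ - J xs - c * μ
    linarith
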